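/- arXiv:2604.08394 — 3 statements merged into one kernel-verified Lean document; each statement's English description precedes it below -/
import Mathlib

section
/- Let A ⊆ P be a pair of finite posets with min(P) ∪ max(P) ⊆ A and let A = {a_0, a_1, …, a_r} be a natural labeling. Then there exists a polynomial f ∈ ℚ[t_1, …, t_r] such that Ω_{P,A}(λ) = f(λ(a_1) − λ(a_0), λ(a_2) − λ(a_1), …, λ(a_r) − λ(a_{r−1})) for every map λ : A → ℤ satisfying λ(a_0) ≤ λ(a_1) ≤ ⋯ ≤ λ(a_r). -/
/-- The number of order preserving maps `λ̂ : α → ℤ` agreeing with `lam` on the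
marked subset `A` (the lattice points of the marked order polytope `O_{P,A}(λ)`). -/
noncomputable def markedCount {α : Type} [PartialOrder α] (A : Set α) (lam : α → ℤ) : ℕ :=
  Nat.card {f : α → ℤ // Monotone f ∧ ∀ a ∈ A, f a = lam a}

theorem mo_sum_pow (k : ℕ) : ∃ T : Polynomial ℚ, ∀ x y : ℤ, x ≤ y →
    ∑ t ∈ Finset.Ioc x y, (t : ℚ) ^ k = T.eval (y : ℚ) - T.eval (x : ℚ) := by
  refine ⟨Polynomial.C ((1 : ℚ) / (k + 1)) * (Polynomial.bernoulli (k + 1)).comp (1 + Polynomial.X), ?_⟩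
  intro x y hxy
  induction y, hxy using Int.leInduction with
  | base => simp
  | succ y hy ih =>
    have h : Finset.Ioc x (y + 1) = insert (y + 1) (Finset.Ioc x y) := by
      ext z; simp only [Finset.mem_Ioc, Finset.mem_insert]; omega
    rw [h, Finset.sum_insert (by simp), ih]
    have hb := Polynomial.bernoulli_eval_one_add (k + 1) ((y : ℚ) + 1)
    have hk : (k : ℚ) + 1 ≠ 0 := by positivity
    simp only [Polynomial.eval_mul, Polynomial.eval_C, Polynomial.eval_comp, Polynomial.eval_add,
      Polynomial.eval_one, Polynomial.eval_X]
    push_cast at hb ⊢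
    rw [hb, add_comm 1 (y : ℚ)]
    field_simp
    ring

theorem mo_sum_poly {α : Type} [Fintype α] [DecidableEq α] (p x y : α)
    (g : MvPolynomial α ℚ) :
    ∃ F : MvPolynomial α ℚ, ∀ lam : α → ℤ, lam x ≤ lam y →
      ∑ t ∈ Finset.Ioc (lam x) (lam y),
        MvPolynomial.eval (fun i => ((Function.update lam p t i : ℤ) : ℚ)) g
      = MvPolynomial.eval (fun i => (lam i : ℚ)) F := by
  induction g using MvPolynomial.induction_on' with
  | monomial s c =>
    obtain ⟨T, hT⟩ := mo_sum_pow (s p)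
    refine ⟨MvPolynomial.C c * (∏ i ∈ Finset.univ.erase p, MvPolynomial.X i ^ s i) *
      (Polynomial.aeval (MvPolynomial.X y) T - Polynomial.aeval (MvPolynomial.X x) T), ?_⟩
    intro lam h
    have e : ∀ z : α, MvPolynomial.eval (fun i => (lam i : ℚ))
        (Polynomial.aeval (MvPolynomial.X z) T) = T.eval (lam z : ℚ) := by
      intro z
      rw [Polynomial.aeval_def, Polynomial.hom_eval₂]
      rw [MvPolynomial.eval_X, Subsingleton.elim ((MvPolynomial.eval fun i => (lam i : ℚ)).comp
        (algebraMap ℚ (MvPolynomial α ℚ))) (RingHom.id ℚ), Polynomial.eval₂_id]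
    have h1 : ∀ t : ℤ, MvPolynomial.eval (fun i => ((Function.update lam p t i : ℤ) : ℚ))
        (MvPolynomial.monomial s c) =
        c * (∏ i ∈ Finset.univ.erase p, (lam i : ℚ) ^ s i) * (t : ℚ) ^ s p := by
      intro t
      rw [MvPolynomial.eval_monomial, Finsupp.prod_fintype _ _ (by simp),
        ← Finset.prod_erase_mul _ _ (Finset.mem_univ p), mul_assoc]
      congr 2
      · apply Finset.prod_congr rfl
        intro i hi
        rw [Function.update_of_ne (Finset.ne_of_mem_erase hi)]
      · simp
    simp only [h1, ← Finset.mul_sum, hT _ _ h, map_mul, map_sub, e, map_prod, map_pow,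
      MvPolynomial.eval_X, MvPolynomial.eval_C]
  | add f g hf hg =>
    obtain ⟨F, hF⟩ := hf
    obtain ⟨G, hG⟩ := hg
    refine ⟨F + G, fun lam h => ?_⟩
    simp only [map_add, Finset.sum_add_distrib, hF lam h, hG lam h]

theorem mo_exists_last {α : Type} (P : α → Prop) (l : List α) (h : ∃ x ∈ l, P x) :
    ∃ l1 x l2, l = l1 ++ x :: l2 ∧ P x ∧ ∀ y ∈ l2, ¬ P y := by
  induction l with
  | nil => simp at h
  | cons b l ih =>
    by_cases hl : ∃ x ∈ l, P x
    · obtain ⟨l1, x, l2, rfl, h2⟩ := ih hl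
      exact ⟨b :: l1, x, l2, rfl, h2⟩
    · push Not at hl
      refine ⟨[], b, l, rfl, ?_, hl⟩
      obtain ⟨x, hx, hP⟩ := h
      rcases List.mem_cons.1 hx with rfl | hx
      · exact hP
      · exact absurd hP (hl x hx)

theorem mo_exists_first {α : Type} (P : α → Prop) (l : List α) (h : ∃ x ∈ l, P x) :
    ∃ l1 x l2, l = l1 ++ x :: l2 ∧ P x ∧ ∀ y ∈ l1, ¬ P y := by
  obtain ⟨l1, x, l2, h1, h2, h3⟩ := mo_exists_last P l.reverse (by simpa using h)
  refine ⟨l2.reverse, x, l1.reverse, ?_, h2, by simpa using h3⟩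
  rw [← List.reverse_reverse l, h1]; simp

theorem mo_finite {α : Type} [Finite α] [PartialOrder α] (A : Set α)
    (hA : ∀ x : α, IsMin x ∨ IsMax x → x ∈ A) (lam : α → ℤ) :
    Finite {f : α → ℤ // Monotone f ∧ ∀ a ∈ A, f a = lam a} := by
  classical
  cases nonempty_fintype α
  have h1 : ∀ p : α, ∃ m, m ≤ p ∧ IsMin m := fun p => by
    obtain ⟨m, hm, h⟩ := Set.toFinite (Set.univ : Set α) |>.exists_le_minimal (Set.mem_univ p)
    exact ⟨m, hm, fun b hb => h.2 (Set.mem_univ b) hb⟩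
  have h2 : ∀ p : α, ∃ m, p ≤ m ∧ IsMax m := fun p => by
    obtain ⟨m, hm, h⟩ := Set.toFinite (Set.univ : Set α) |>.exists_le_maximal (Set.mem_univ p)
    exact ⟨m, hm, fun b hb => h.2 (Set.mem_univ b) hb⟩
  choose lo hlo hlo' using h1
  choose hi hhi hhi' using h2
  refine ((Set.finite_Icc (fun p => lam (lo p)) (fun p => lam (hi p))).subset ?_ :
    Set.Finite {f : α → ℤ | Monotone f ∧ ∀ a ∈ A, f a = lam a})
  rintro f ⟨hf, hfa⟩
  refine ⟨fun p => ?_, fun p => ?_⟩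
  · show lam (lo p) ≤ f p
    rw [← hfa _ (hA _ (Or.inl (hlo' p)))]; exact hf (hlo p)
  · show f p ≤ lam (hi p)
    rw [← hfa _ (hA _ (Or.inr (hhi' p)))]; exact hf (hhi p)

theorem mo_split {α : Type} [Finite α] [DecidableEq α] [PartialOrder α] (A : Set α)
    (hA : ∀ x : α, IsMin x ∨ IsMax x → x ∈ A) (p x y : α) (hp : p ∉ A) (hx : x ∈ A) (hy : y ∈ A)
    (hxp : x < p) (hpy : p < y) (lam : α → ℤ) :
    markedCount A lam =
      ∑ t ∈ Finset.Icc (lam x) (lam y), markedCount (insert p A) (Function.update lam p t) := by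
  have hfin := fun t : ℤ => mo_finite (insert p A) (fun x hx => Or.inr (hA x hx))
    (Function.update lam p t)
  have key : ∀ (t : ℤ) (f : α → ℤ),
      (∀ a ∈ insert p A, f a = Function.update lam p t a) ↔ f p = t ∧ ∀ a ∈ A, f a = lam a := by
    intro t f
    have : ∀ a ∈ A, Function.update lam p t a = lam a := fun a ha =>
      Function.update_of_ne (by rintro rfl; exact hp ha) _ _
    constructor
    · intro h
      exact ⟨by simpa using h p (Or.inl rfl), fun a ha => by rw [h a (Or.inr ha), this a ha]⟩
    · rintro ⟨h1, h2⟩ a (rfl | ha)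
      · simpa using h1
      · rw [h2 a ha, this a ha]
  rw [← Finset.sum_coe_sort]
  unfold markedCount
  rw [← Nat.card_sigma]
  apply Nat.card_congr
  refine ⟨fun f => ⟨⟨f.1 p, ?_⟩, ⟨f.1, f.2.1, (key _ _).2 ⟨rfl, f.2.2⟩⟩⟩,
    fun q => ⟨q.2.1, q.2.2.1, ((key _ _).1 q.2.2.2).2⟩, ?_, ?_⟩
  · rw [Finset.mem_Icc, ← f.2.2 x hx, ← f.2.2 y hy]
    exact ⟨f.2.1 hxp.le, f.2.1 hpy.le⟩
  · intro f; rfl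
  · rintro ⟨⟨t, ht⟩, f, hf, hf2⟩
    obtain ⟨rfl, -⟩ := (key _ _).1 hf2
    rfl

theorem mo_seg {α : Type} [Fintype α] [DecidableEq α] (p : α) (c : (α → ℤ) → ℤ → ℚ)
    (l : List α) (y : α) (l2 : List α) (m : List α) : ∀ (l1 : List α) (x : α),
    l = l1 ++ x :: (m ++ y :: l2) →
    (∀ k1 z w k2, x :: (m ++ [y]) = k1 ++ z :: w :: k2 → ∃ g : MvPolynomial α ℚ,
      ∀ lam : α → ℤ, l.Pairwise (fun u v => lam u ≤ lam v) → ∀ t, lam z ≤ t → t ≤ lam w →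
        c lam t = MvPolynomial.eval (fun i => ((Function.update lam p t i : ℤ) : ℚ)) g) →
    ∃ F : MvPolynomial α ℚ, ∀ lam : α → ℤ, l.Pairwise (fun u v => lam u ≤ lam v) →
      ∑ t ∈ Finset.Ioc (lam x) (lam y), c lam t = MvPolynomial.eval (fun i => (lam i : ℚ)) F := by
  have base : ∀ x z : α, (∀ lam : α → ℤ, l.Pairwise (fun u v => lam u ≤ lam v) → lam x ≤ lam z) →
    (∃ g : MvPolynomial α ℚ,
      ∀ lam : α → ℤ, l.Pairwise (fun u v => lam u ≤ lam v) → ∀ t, lam x ≤ t → t ≤ lam z →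
        c lam t = MvPolynomial.eval (fun i => ((Function.update lam p t i : ℤ) : ℚ)) g) →
    ∃ F : MvPolynomial α ℚ, ∀ lam : α → ℤ, l.Pairwise (fun u v => lam u ≤ lam v) →
      ∑ t ∈ Finset.Ioc (lam x) (lam z), c lam t = MvPolynomial.eval (fun i => (lam i : ℚ)) F := by
    rintro x z hle ⟨g, hg⟩
    obtain ⟨F, hF⟩ := mo_sum_poly p x z g
    refine ⟨F, fun lam hl => ?_⟩
    rw [← hF lam (hle lam hl)]
    refine Finset.sum_congr rfl fun t ht => ?_
    rw [Finset.mem_Ioc] at ht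
    exact hg lam hl t ht.1.le ht.2
  induction m with
  | nil =>
    intro l1 x hl H
    refine base x y (fun lam h => ?_) (H [] x y [] rfl)
    rw [hl, List.pairwise_append] at h
    exact (List.pairwise_cons.1 h.2.1).1 y (by simp)
  | cons z m ih =>
    intro l1 x hl H
    have hle : ∀ lam : α → ℤ, l.Pairwise (fun u v => lam u ≤ lam v) →
        lam x ≤ lam z ∧ lam z ≤ lam y := fun lam h => by
      rw [hl, List.pairwise_append] at h
      have h2 := List.pairwise_cons.1 h.2.1
      exact ⟨h2.1 z (by simp), (List.pairwise_cons.1 h2.2).1 y (by simp)⟩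
    obtain ⟨F, hF⟩ := base x z (fun lam h => (hle lam h).1) (H [] x z (m ++ [y]) rfl)
    obtain ⟨G, hG⟩ := ih (l1 ++ [x]) z (by simp [hl]) (fun k1 u v k2 e =>
      H (x :: k1) u v k2 (by simpa using e))
    refine ⟨F + G, fun lam h => ?_⟩
    rw [map_add, ← hF lam h, ← hG lam h, ← Finset.sum_union
      (Finset.Ioc_disjoint_Ioc_of_le le_rfl),
      Finset.Ioc_union_Ioc_eq_Ioc (hle lam h).1 (hle lam h).2]

theorem mo_main {α : Type} [Fintype α] [DecidableEq α] [PartialOrder α] (n : ℕ) :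
    ∀ l : List α, (Finset.univ.filter (· ∉ l)).card = n →
    (∀ x : α, IsMin x ∨ IsMax x → x ∈ l) → l.Pairwise (fun u v => ¬ v < u) →
    ∃ F : MvPolynomial α ℚ, ∀ lam : α → ℤ, l.Pairwise (fun u v => lam u ≤ lam v) →
      (markedCount {x | x ∈ l} lam : ℚ) = MvPolynomial.eval (fun i => (lam i : ℚ)) F := by
  induction n with
  | zero =>
    intro l hn hmm hpw
    have hall : ∀ x, x ∈ l := by
      intro x
      by_contra hx
      rw [Finset.card_eq_zero] at hn
      exact Finset.notMem_empty x (hn ▸ Finset.mem_filter.2 ⟨Finset.mem_univ x, hx⟩)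
    refine ⟨1, fun lam hlam => ?_⟩
    have hmono : Monotone lam := by
      intro u v huv
      rcases huv.eq_or_lt with rfl | huv
      · exact le_rfl
      obtain ⟨i, hi, rfl⟩ := List.getElem_of_mem (hall u)
      obtain ⟨j, hj, rfl⟩ := List.getElem_of_mem (hall v)
      rw [List.pairwise_iff_getElem] at hlam hpw
      rcases lt_trichotomy i j with h | rfl | h
      · exact hlam i j hi hj h
      · exact le_rfl
      · exact absurd huv (hpw j i hj hi h)
    rw [map_one]
    unfold markedCount
    have : Nat.card {f : α → ℤ // Monotone f ∧ ∀ a ∈ {x | x ∈ l}, f a = lam a} = 1 := by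
      rw [Nat.card_eq_one_iff_unique]
      refine ⟨⟨fun f g => Subtype.ext (funext fun x => ?_)⟩, ⟨⟨lam, hmono, fun _ _ => rfl⟩⟩⟩
      rw [f.2.2 x (hall x), g.2.2 x (hall x)]
    rw [this]; simp
  | succ n IH =>
    intro l hn hmm hpw
    obtain ⟨p, hp⟩ : ∃ p, p ∈ Finset.univ.filter (· ∉ l) := by
      apply Finset.card_pos.1; omega
    have hpl : p ∉ l := (Finset.mem_filter.1 hp).2
    have hlow : ∃ x ∈ l, x < p := by
      obtain ⟨m, hm, h⟩ := Set.toFinite (Set.univ : Set α) |>.exists_le_minimal (Set.mem_univ p)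
      have hml : m ∈ l := hmm m (Or.inl fun b hb => h.2 (Set.mem_univ b) hb)
      exact ⟨m, hml, lt_of_le_of_ne hm (by rintro rfl; exact hpl hml)⟩
    have hupp : ∃ x ∈ l, p < x := by
      obtain ⟨m, hm, h⟩ := Set.toFinite (Set.univ : Set α) |>.exists_le_maximal (Set.mem_univ p)
      have hml : m ∈ l := hmm m (Or.inr fun b hb => h.2 (Set.mem_univ b) hb)
      exact ⟨m, hml, lt_of_le_of_ne hm (by rintro rfl; exact hpl hml)⟩
    obtain ⟨l1, x, l', hl, hxp, hl'⟩ := mo_exists_last (· < p) l hlow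
    have hpw0 := hpw
    rw [hl, List.pairwise_append] at hpw0
    have hl1p : ∀ z ∈ l1 ++ [x], ¬ p < z := by
      intro z hz hpz
      rcases List.mem_append.1 hz with hz | hz
      · exact hpw0.2.2 z hz x (by simp) (hxp.trans hpz)
      · rw [List.mem_singleton] at hz; subst hz; exact lt_asymm hpz hxp
    have hupp' : ∃ y ∈ l', p < y := by
      obtain ⟨y, hy, hpy⟩ := hupp
      refine ⟨y, ?_, hpy⟩
      have : y ∉ l1 ++ [x] := fun h => hl1p y h hpy
      rw [hl] at hy
      simp only [List.mem_append, List.mem_cons, List.mem_singleton, not_or] at hy this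
      tauto
    obtain ⟨m, y, l2, hm, hpy, hmp⟩ := mo_exists_first (p < ·) l' hupp'
    have ins : ∀ k1 k2, x :: (m ++ [y]) = k1 ++ k2 → k1 ≠ [] → k2 ≠ [] →
        ∃ g : MvPolynomial α ℚ, ∀ lam : α → ℤ, l.Pairwise (fun u v => lam u ≤ lam v) → ∀ t,
          (∀ z ∈ k1.getLast?, lam z ≤ t) → (∀ z ∈ k2.head?, t ≤ lam z) →
          (markedCount (insert p {x | x ∈ l}) (Function.update lam p t) : ℚ) =
            MvPolynomial.eval (fun i => ((Function.update lam p t i : ℤ) : ℚ)) g := by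
      intro k1 k2 hk hk1 hk2
      have hl3 : l = (l1 ++ k1) ++ (k2 ++ l2) := by
        rw [hl, hm]
        calc _ = l1 ++ (x :: (m ++ [y])) ++ l2 := by simp
          _ = _ := by rw [hk]; simp
      have hset : {z | z ∈ (l1 ++ k1) ++ p :: (k2 ++ l2)} = insert p {x | x ∈ l} := by
        rw [hl3]; ext z
        simp only [Set.mem_ofPred_eq, Set.mem_insert_iff, List.mem_append, List.mem_cons]; tauto
      have hset' : ∀ z, z ∈ (l1 ++ k1) ++ p :: (k2 ++ l2) ↔ z = p ∨ z ∈ l := fun z => by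
        have := Set.ext_iff.1 hset z; simpa using this
      have hk1' : ∀ z ∈ k1, z ∈ x :: m := by
        intro z hz
        obtain ⟨k3, b, rfl⟩ := List.eq_nil_or_concat k2 |>.resolve_left hk2
        have : (x :: m) ++ [y] = (k1 ++ k3) ++ [b] := by simpa using hk
        have := (List.append_inj' this rfl).1
        rw [this]; simp [hz]
      have hk2' : ∀ z ∈ k2, z ∈ m ++ [y] := by
        intro z hz
        obtain ⟨b, k3, rfl⟩ := List.exists_cons_of_ne_nil hk1
        simp only [List.cons_append, List.cons.injEq] at hk
        rw [hk.2]; simp [hz]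
      obtain ⟨g, hg⟩ := IH ((l1 ++ k1) ++ p :: (k2 ++ l2)) (by
          have : Finset.univ.filter (· ∉ (l1 ++ k1) ++ p :: (k2 ++ l2)) =
              (Finset.univ.filter (· ∉ l)).erase p := by
            ext z
            rw [Finset.mem_filter, Finset.mem_erase, Finset.mem_filter, hset']; tauto
          rw [this, Finset.card_erase_of_mem hp, hn]; rfl)
        (fun z hz => (hset' z).2 (Or.inr (hmm z hz))) (by
          have hpw1 := hpw
          rw [hl3, List.pairwise_append] at hpw1
          rw [List.pairwise_append]
          refine ⟨hpw1.1, List.pairwise_cons.2 ⟨?_, hpw1.2.1⟩, ?_⟩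
          · intro z hz
            refine hl' z ?_
            rw [hm]
            rcases List.mem_append.1 hz with hz | hz
            · have := hk2' z hz
              simp only [List.mem_append, List.mem_cons, List.mem_singleton] at this ⊢; tauto
            · simp [hz]
          · intro u hu v hv
            rcases List.mem_cons.1 hv with rfl | hv
            · rcases List.mem_append.1 hu with hu | hu
              · exact hl1p u (by simp [hu])
              · rcases List.mem_cons.1 (hk1' u hu) with rfl | hu
                · exact hl1p u (by simp)
                · exact hmp u hu
            · exact hpw1.2.2 u hu v hv)
      refine ⟨g, fun lam hlam t h1 h2 => ?_⟩
      rw [← hset]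
      refine hg _ ?_
      have hupd : ∀ z ∈ l, Function.update lam p t z = lam z := fun z hz =>
        Function.update_of_ne (by rintro rfl; exact hpl hz) _ _
      have hlam' : l.Pairwise (fun u v => Function.update lam p t u ≤ Function.update lam p t v) :=
        hlam.imp_of_mem (fun ha hb h => by rw [hupd _ ha, hupd _ hb]; exact h)
      rw [hl3, List.pairwise_append] at hlam' hlam
      rw [List.pairwise_append]
      have hleft : ∀ u ∈ l1 ++ k1, lam u ≤ t := by
        intro u hu
        obtain ⟨k3, b, rfl⟩ := List.eq_nil_or_concat k1 |>.resolve_left hk1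
        have hb : lam b ≤ t := h1 b (by simp)
        have h4 : ((l1 ++ k3) ++ [b]).Pairwise (fun u v => lam u ≤ lam v) := by
          simpa using hlam.1
        have h5 : u ∈ l1 ++ k3 ∨ u = b := by
          simp only [List.mem_append, List.concat_eq_append, List.mem_singleton] at hu ⊢; tauto
        rcases h5 with h5 | rfl
        · exact ((List.pairwise_append.1 h4).2.2 u h5 b (by simp)).trans hb
        · exact hb
      have hright : ∀ u ∈ k2 ++ l2, t ≤ lam u := by
        intro u hu
        obtain ⟨b, k3, rfl⟩ := List.exists_cons_of_ne_nil hk2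
        have hb : t ≤ lam b := h2 b (by simp)
        rcases List.mem_cons.1 hu with rfl | hu
        · exact hb
        · exact hb.trans ((List.pairwise_cons.1 hlam.2.1).1 u hu)
      have hmem1 : ∀ u ∈ l1 ++ k1, u ∈ l := fun u hu => by
        rw [hl3]; exact List.mem_append_left _ hu
      have hmem2 : ∀ u ∈ k2 ++ l2, u ∈ l := fun u hu => by
        rw [hl3]; exact List.mem_append_right _ hu
      refine ⟨hlam'.1, List.pairwise_cons.2 ⟨?_, hlam'.2.1⟩, ?_⟩
      · intro z hz
        rw [Function.update_self, hupd z (hmem2 z hz)]; exact hright z hz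
      · intro u hu v hv
        rcases List.mem_cons.1 hv with rfl | hv
        · rw [Function.update_self, hupd u (hmem1 u hu)]; exact hleft u hu
        · exact hlam'.2.2 u hu v hv
    have hle : ∀ lam : α → ℤ, l.Pairwise (fun u v => lam u ≤ lam v) →
        lam x ≤ lam y ∧ ∀ z ∈ (m ++ [y]).head?, lam x ≤ lam z := fun lam h => by
      rw [hl, hm, List.pairwise_append] at h
      have h2 := List.pairwise_cons.1 h.2.1
      refine ⟨h2.1 y (by simp), fun z hz => h2.1 z ?_⟩
      have := List.mem_of_mem_head? hz
      simp only [List.mem_append, List.mem_cons, List.mem_singleton] at this ⊢; tauto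
    obtain ⟨F, hF⟩ := mo_seg p
      (fun lam t => (markedCount (insert p {x | x ∈ l}) (Function.update lam p t) : ℚ))
      l y l2 m l1 x (by rw [hl, hm]) (fun k1 z w k2 hk => by
        obtain ⟨g, hg⟩ := ins (k1 ++ [z]) (w :: k2) (by simp [hk]) (by simp) (by simp)
        exact ⟨g, fun lam hlam t h1 h2 => hg lam hlam t (by simpa using h1) (by simpa using h2)⟩)
    obtain ⟨g, hg⟩ := ins [x] (m ++ [y]) rfl (by simp) (by simp)
    refine ⟨MvPolynomial.bind₁ (fun i => MvPolynomial.X (Function.update id p x i)) g + F,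
      fun lam hlam => ?_⟩
    obtain ⟨hxy, hxz⟩ := hle lam hlam
    rw [mo_split {x | x ∈ l} hmm p x y hpl (by simp [hl]) (by simp [hl, hm]) hxp hpy lam,
      ← Finset.Ioc_insert_left hxy, Finset.sum_insert (by simp)]
    push_cast
    rw [map_add, ← hF lam hlam, hg lam hlam (lam x) (by simp) hxz]
    congr 1
    rw [← MvPolynomial.coe_aeval_eq_eval, ← MvPolynomial.coe_aeval_eq_eval, RingHom.coe_coe,
      RingHom.coe_coe, MvPolynomial.aeval_bind₁]
    congr 2
    funext i
    by_cases hi : i = p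
    · subst hi; simp
    · simp [Function.update_of_ne hi]

theorem mo_shift {α : Type} [PartialOrder α] (A : Set α) (lam mu : α → ℤ) (c : ℤ)
    (h : ∀ a ∈ A, mu a = lam a - c) : markedCount A lam = markedCount A mu := by
  unfold markedCount
  apply Nat.card_congr
  refine ⟨fun f => ⟨fun x => f.1 x - c, fun x y hxy => sub_le_sub_right (f.2.1 hxy) c,
      fun a ha => by simp only [h a ha, f.2.2 a ha]⟩,
    fun f => ⟨fun x => f.1 x + c, fun x y hxy => add_le_add_left (f.2.1 hxy) c,
      fun a ha => by simp only [f.2.2 a ha, h a ha]; ring⟩, fun f => ?_, fun f => ?_⟩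
  · ext x; simp
  · ext x; simp

theorem mo_tele (r : ℕ) (i : Fin (r + 1)) : ∃ q : MvPolynomial (Fin r) ℚ, ∀ v : Fin (r + 1) → ℚ,
    MvPolynomial.eval (fun i : Fin r => v i.succ - v i.castSucc) q = v i - v 0 := by
  induction i using Fin.induction with
  | zero => exact ⟨0, fun v => by simp⟩
  | succ i ih =>
    obtain ⟨q, hq⟩ := ih
    refine ⟨q + MvPolynomial.X i, fun v => ?_⟩
    rw [map_add, hq, MvPolynomial.eval_X]; ring

/-- **Theorem (piecewise polynomiality).** For a pair of finite posets `A ⊆ P` with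
`min(P) ∪ max(P) ⊆ A` and a natural labeling `A = {a_0, …, a_r}`, there is a
polynomial `f ∈ ℚ[t_1, …, t_r]` such that
`Ω_{P,A}(λ) = f(λ(a_1) − λ(a_0), …, λ(a_r) − λ(a_{r−1}))`
for every `λ : A → ℤ` with `λ(a_0) ≤ λ(a_1) ≤ ⋯ ≤ λ(a_r)`. -/
theorem marked_order_polynomiality
    {α : Type} [Finite α] [PartialOrder α]
    (A : Set α) (hminmax : ∀ x : α, IsMin x ∨ IsMax x → x ∈ A)
    (r : ℕ) (a : Fin (r + 1) → α) (hinj : Function.Injective a)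
    (hrange : Set.range a = A)
    (hnat : ∀ i j : Fin (r + 1), a i < a j → i < j) :
    ∃ f : MvPolynomial (Fin r) ℚ,
      ∀ lam : α → ℤ, (∀ i j : Fin (r + 1), i ≤ j → lam (a i) ≤ lam (a j)) →
        (markedCount A lam : ℚ) =
          MvPolynomial.eval
            (fun i : Fin r => ((lam (a i.succ) : ℚ) - (lam (a i.castSucc) : ℚ))) f := by
  classical
  cases nonempty_fintype α
  subst hrange
  have hset : {x | x ∈ List.ofFn a} = Set.range a := by ext x; exact List.mem_ofFn
  obtain ⟨F, hF⟩ := mo_main _ (List.ofFn a) rfl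
    (fun x hx => List.mem_ofFn.2 (hminmax x hx))
    (by
      rw [List.pairwise_ofFn]
      exact fun i j hij h => lt_asymm hij (hnat j i h))
  rw [hset] at hF
  choose q hq using mo_tele r
  refine ⟨MvPolynomial.bind₁ (fun z => if h : ∃ i, a i = z then q h.choose else 0) F,
    fun lam hlam => ?_⟩
  have hF' := hF (fun z => if ∃ i, a i = z then lam z - lam (a 0) else 0) (by
    rw [List.pairwise_ofFn]
    intro i j hij
    simpa using hlam i j hij.le)
  rw [mo_shift _ lam (fun z => if ∃ i, a i = z then lam z - lam (a 0) else 0) (lam (a 0))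
    (by rintro _ ⟨i, rfl⟩; simp), hF']
  rw [← MvPolynomial.coe_aeval_eq_eval, ← MvPolynomial.coe_aeval_eq_eval, RingHom.coe_coe,
      RingHom.coe_coe, MvPolynomial.aeval_bind₁]
  congr 2
  funext z
  by_cases h : ∃ i, a i = z
  · rw [if_pos h, dif_pos h, MvPolynomial.aeval_eq_eval]
    have := hq h.choose (fun i => (lam (a i) : ℚ))
    rw [h.choose_spec] at this
    exact (Int.cast_sub _ _).trans this.symm
  · rw [if_neg h, dif_neg h]; simp
end

section
/- For any k ≥ 1, m ≥ 1 and any vectors y, z ∈ ℤ_{≥0}^k, the m-generalized Pitman–Stanley polytope PS_k^m(y,z) is Ehrhart positive: there exists a polynomial p ∈ ℚ[n] with nonnegative coefficients such that for all integers n ≥ 1, p(n) equals the number of integer points (x_{i,j}) ∈ ℤ^{km} satisfying n·z̃_i ≤ x_{i,1} ≤ x_{i,2} ≤ ⋯ ≤ x_{i,m} ≤ n·ỹ_i for all i ∈ [k] and x_{i,j} ≤ x_{i+1,j} for all i ∈ [k−1], j ∈ [m]. -/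
open Polynomial

noncomputable section

/-- The polynomial `y (y+1) ⋯ (y+r-1) / r!`. -/
def PSg (r : ℕ) (y : ℚ[X]) : ℚ[X] :=
  C ((r.factorial : ℚ)⁻¹) * ∏ k ∈ Finset.range r, (y + C (k : ℚ))

/-- Entries of the Kreweras matrix, as polynomials. -/
def PSPhi (x d : ℤ) : ℚ[X] :=
  if x < d then 0 else PSg (x - d).toNat (X + C (d : ℚ))

lemma PSPhi_of_lt {x d : ℤ} (h : x < d) : PSPhi x d = 0 := by
  simp [PSPhi, h]

lemma PSPhi_self (x : ℤ) : PSPhi x x = 1 := by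
  simp [PSPhi, PSg]

lemma PSPhi_of_eq {x d : ℤ} (r : ℕ) (h : x = d + r) :
    PSPhi x d = PSg r (X + C (d : ℚ)) := by
  subst h
  simp [PSPhi]

lemma PSPhi_R2 (x d : ℤ) (n : ℚ) :
    (PSPhi (x - 1) d).eval (n + 1) = (PSPhi x (d + 1)).eval n := by
  by_cases h : x < d + 1
  · rw [PSPhi_of_lt h, PSPhi_of_lt (by omega)]; simp
  · obtain ⟨r, hr⟩ := Int.eq_ofNat_of_zero_le (show 0 ≤ x - (d + 1) by omega)
    rw [PSPhi_of_eq r (by omega), PSPhi_of_eq (x := x) r (by omega)]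
    simp only [PSg, eval_mul, eval_C, eval_prod, eval_add, eval_X]
    congr 1
    apply Finset.prod_congr rfl
    intro k _
    push_cast
    ring

lemma PSPhi_R1 (x d : ℤ) (n : ℚ) :
    (PSPhi x d).eval (n + 1) = (PSPhi (x - 1) d).eval (n + 1) + (PSPhi x d).eval n := by
  by_cases h : x < d
  · rw [PSPhi_of_lt h, PSPhi_of_lt (by omega)]; simp
  · obtain ⟨r, hr⟩ := Int.eq_ofNat_of_zero_le (show 0 ≤ x - d by omega)
    rw [PSPhi_of_eq (x := x) r (by omega)]
    cases r with
    | zero =>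
      rw [PSPhi_of_lt (by omega)]
      simp [PSg]
    | succ r =>
      rw [PSPhi_of_eq r (by push_cast at hr; omega)]
      simp only [PSg, eval_mul, eval_C, eval_prod, eval_add, eval_X]
      rw [Finset.prod_range_succ, Finset.prod_range_succ' (fun k : ℕ => n + (d : ℚ) + (k : ℚ))]
      have : ∀ k : ℕ, n + (d : ℚ) + ((k + 1 : ℕ) : ℚ) = n + 1 + d + k := by
        intro k; push_cast; ring
      simp only [this]
      have hf : (r.factorial : ℚ) ≠ 0 := by positivity
      rw [Nat.factorial_succ]
      push_cast
      have hr' : (r : ℚ) + 1 ≠ 0 := by positivity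
      field_simp
      ring

lemma PSPhi_upper (x d : ℤ) (hx : 0 < x) (hd : d ≤ 0) :
    ∃ Q : ℚ[X], PSPhi x d = X * Q ∧ 0 ≤ (-1 : ℚ) ^ d.natAbs * Q.eval 0 := by
  obtain ⟨e, he⟩ := Int.eq_ofNat_of_zero_le (show 0 ≤ - d by omega)
  obtain ⟨s, hs⟩ := Int.eq_ofNat_of_zero_le (show 0 ≤ x - 1 by omega)
  have hd' : d = - (e : ℤ) := by omega
  subst hd'
  rw [PSPhi_of_eq (e + (s + 1)) (by push_cast; omega)]
  refine ⟨C (((e + (s + 1)).factorial : ℚ)⁻¹) *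
    ((∏ k ∈ Finset.range e, (X + C ((-(e : ℤ) : ℤ) : ℚ) + C (k : ℚ))) *
      ∏ k ∈ Finset.range s, (X + C ((k : ℚ) + 1))), ?_, ?_⟩
  · rw [PSg, Finset.prod_range_add, Finset.prod_range_succ']
    have h1 : ∀ k : ℕ, (X : ℚ[X]) + C ((-(e : ℤ) : ℤ) : ℚ) + C (((e + (k + 1) : ℕ)) : ℚ)
        = X + C ((k : ℚ) + 1) := by
      intro k
      rw [add_assoc, ← C_add]; congr 2; push_cast; ring
    have h2 : (X : ℚ[X]) + C ((-(e : ℤ) : ℤ) : ℚ) + C (((e + 0 : ℕ)) : ℚ) = X := by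
      rw [add_assoc, ← C_add]; simp
    simp only [h1, h2]
    ring
  · simp only [eval_mul, eval_C, eval_prod, eval_add, eval_X]
    have h3 : (-1 : ℚ) ^ (-(e : ℤ)).natAbs = ∏ k ∈ Finset.range e, (-1 : ℚ) := by simp
    rw [h3]
    have : (∏ k ∈ Finset.range e, (-1 : ℚ)) * (((e + (s + 1)).factorial : ℚ)⁻¹ *
      ((∏ k ∈ Finset.range e, (0 + ((-(e : ℤ) : ℤ) : ℚ) + (k : ℚ))) *
      ∏ k ∈ Finset.range s, (0 + ((k : ℚ) + 1)))) = (((e + (s + 1)).factorial : ℚ)⁻¹ *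
      ((∏ k ∈ Finset.range e, ((-1) * (0 + ((-(e : ℤ) : ℤ) : ℚ) + (k : ℚ)))) *
      ∏ k ∈ Finset.range s, (0 + ((k : ℚ) + 1)))) := by
      rw [Finset.prod_mul_distrib]; ring
    rw [this]
    refine mul_nonneg (by positivity) (mul_nonneg ?_ ?_)
    · apply Finset.prod_nonneg
      intro k hk
      have : (k : ℚ) < e := by exact_mod_cast Finset.mem_range.1 hk
      push_cast
      linarith
    · apply Finset.prod_nonneg
      intro k hk
      positivity

lemma PSPhi_sub (x : ℤ) (hx : 1 ≤ x) : (PSPhi x 1).eval 0 = 1 := by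
  obtain ⟨r, hr⟩ := Int.eq_ofNat_of_zero_le (show 0 ≤ x - 1 by omega)
  rw [PSPhi_of_eq r (by omega)]
  simp only [PSg, eval_mul, eval_C, eval_prod, eval_add, eval_X]
  have : ∏ k ∈ Finset.range r, (0 + ((1 : ℤ) : ℚ) + (k : ℚ)) = r.factorial := by
    rw [← Finset.prod_range_add_one_eq_factorial]
    push_cast
    apply Finset.prod_congr rfl
    intro k _
    ring
  rw [this]
  have hf : (r.factorial : ℚ) ≠ 0 := by positivity
  field_simp

/-- The Kreweras matrix. -/
def PSM {l : ℕ} (μ ν : Fin l → ℕ) : Matrix (Fin l) (Fin l) ℚ[X] :=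
  Matrix.of fun i j => PSPhi ((ν i : ℤ) - μ j) ((i : ℤ) - j)

/-- The Kreweras determinant. -/
def PSP {l : ℕ} (μ ν : Fin l → ℕ) : ℚ[X] := (PSM μ ν).det

lemma PS_alt_sum {V : Type*} [AddCommGroup V] [Module ℚ V] :
    ∀ (l : ℕ) (D : V [⋀^Fin l]→ₗ[ℚ] ℚ) (R S : Fin l → ℤ → V)
      (_ : ∀ i x, S i x = S i (x - 1) + R i x)
      (_ : ∀ (i j : Fin l) x, (j : ℕ) = i + 1 → S i (x - 1) = R j x)
      (_ : ∀ i : Fin l, (i : ℕ) + 1 = l → S i (-1) = 0)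
      (b : Fin l → ℕ) (_ : Antitone b),
      ∑ ν ∈ (Fintype.piFinset fun i => Finset.range (b i + 1)).filter (fun ν => Antitone ν),
        D (fun i => R i (ν i)) = D (fun i => S i (b i)) := by
  classical
  intro l
  induction l with
  | zero =>
    intro D R S h1 h2 h3 b hb
    rw [Finset.sum_eq_single (fun i => i.elim0)]
    · congr 1; ext i; exact i.elim0
    · intro c _ hc; exact absurd (Subsingleton.elim _ _) hc
    · intro h; exfalso; apply h
      simp only [Finset.mem_filter, Fintype.mem_piFinset]
      exact ⟨fun i => i.elim0, fun i => i.elim0⟩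
  | succ l ih =>
    intro D R S h1 h2 h3 b hb
    have tel : ∀ (i : Fin (l+1)) (a : ℕ) (t : ℕ),
        ∑ v ∈ Finset.Ico a (a + t), R i (v : ℤ) = S i ((a + t : ℕ) - 1 : ℤ) - S i (a - 1) := by
      intro i a t
      induction t with
      | zero => simp
      | succ t iht =>
        rw [← add_assoc, Finset.sum_Ico_succ_top (by omega), iht, h1 i ((a + t + 1 : ℕ) - 1 : ℤ)]
        have e1 : (((a + t + 1 : ℕ) : ℤ) - 1) = ((a + t : ℕ) : ℤ) := by push_cast; ring
        rw [e1]; abel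
    -- split off the first coordinate
    have split : ∀ F : (Fin (l+1) → ℕ) → ℚ,
        ∑ ν ∈ (Fintype.piFinset fun i => Finset.range (b i + 1)).filter
          (fun ν => Antitone ν), F ν =
        ∑ ν' ∈ (Fintype.piFinset fun i : Fin l => Finset.range (b i.succ + 1)).filter
          (fun ν => Antitone ν),
          ∑ v ∈ Finset.Ico (if h : 0 < l then ν' ⟨0, h⟩ else 0) (b 0 + 1),
            F (Fin.cons v ν') := by
      intro F
      rw [Finset.sum_sigma']
      refine Finset.sum_bij' (fun ν _ => ⟨Fin.tail ν, ν 0⟩) (fun p _ => Fin.cons p.2 p.1)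
        ?_ ?_ ?_ ?_ ?_
      · intro ν hν
        simp only [Finset.mem_filter, Fintype.mem_piFinset, Finset.mem_range] at hν
        simp only [Finset.mem_sigma, Finset.mem_filter, Fintype.mem_piFinset, Finset.mem_range,
          Finset.mem_Ico]
        refine ⟨⟨fun i => hν.1 _, fun i j hij => hν.2 (Fin.succ_le_succ_iff.2 hij)⟩, ?_, hν.1 0⟩
        split_ifs with h
        · exact hν.2 (Fin.zero_le _)
        · omega
      · rintro ⟨ν', v⟩ h
        simp only [Finset.mem_sigma, Finset.mem_filter, Fintype.mem_piFinset, Finset.mem_range,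
          Finset.mem_Ico] at h
        simp only [Finset.mem_filter, Fintype.mem_piFinset, Finset.mem_range]
        refine ⟨?_, ?_⟩
        · intro i
          refine Fin.cases ?_ ?_ i
          · simpa using h.2.2
          · intro i; simpa using h.1.1 i
        · intro i j
          refine Fin.cases ?_ (fun j => ?_) j
          · intro hij
            have : i = 0 := by simpa using hij
            subst this; rfl
          · refine Fin.cases ?_ (fun i => ?_) i
            · intro _
              have hl : 0 < l := by have := j.2; omega
              have h21 := h.2.1
              rw [dif_pos hl] at h21
              simp only [Fin.cons_succ, Fin.cons_zero]
              refine le_trans (h.1.2 ?_) h21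
              exact Fin.mk_le_of_le_val (by simp)
            · intro hij
              simp only [Fin.cons_succ]
              exact h.1.2 (Fin.succ_le_succ_iff.1 hij)
      · intro ν _
        simp
      · rintro ⟨ν', v⟩ _
        simp
      · intro ν _
        simp
    rw [split]
    have key : ∀ ν' ∈ (Fintype.piFinset fun i : Fin l => Finset.range (b i.succ + 1)).filter
          (fun ν => Antitone ν),
          ∑ v ∈ Finset.Ico (if h : 0 < l then ν' ⟨0, h⟩ else 0) (b 0 + 1),
            D (fun i => R i ((Fin.cons v ν' : Fin (l+1) → ℕ) i)) =
          (D.curryLeft (S 0 (b 0))) (fun i => R i.succ (ν' i)) := by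
      intro ν' hν'
      simp only [Finset.mem_filter, Fintype.mem_piFinset, Finset.mem_range] at hν'
      have e1 : ∀ v : ℕ, D (fun i => R i ((Fin.cons v ν' : Fin (l+1) → ℕ) i)) =
          (D.curryLeft (R 0 v)) (fun i => R i.succ (ν' i)) := by
        intro v
        rw [AlternatingMap.curryLeft_apply_apply]
        congr 1
        ext i
        refine Fin.cases ?_ (fun i => ?_) i
        · simp
        · simp
      simp only [e1]
      set a := (if h : 0 < l then ν' ⟨0, h⟩ else 0) with ha
      have hab : a ≤ b 0 := by
        rw [ha]; split_ifs with h
        · have := hν'.1 ⟨0, h⟩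
          have h2 : b (Fin.succ ⟨0, h⟩) ≤ b 0 := hb (Fin.zero_le _)
          omega
        · omega
      obtain ⟨t, ht⟩ := Nat.exists_eq_add_of_le (show a ≤ b 0 + 1 by omega)
      have := tel 0 a t
      rw [← ht] at this
      have e2 : ∑ v ∈ Finset.Ico a (b 0 + 1), (D.curryLeft (R 0 v)) (fun i => R i.succ (ν' i)) =
          D.curryLeft (∑ v ∈ Finset.Ico a (b 0 + 1), R 0 v) (fun i => R i.succ (ν' i)) := by
        generalize Finset.Ico a (b 0 + 1) = s
        induction s using Finset.induction_on with
        | empty => simp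
        | insert v s hv ihs =>
          rw [Finset.sum_insert hv, Finset.sum_insert hv, map_add, AlternatingMap.add_apply, ihs]
      rw [e2, this]
      have e3 : (((b 0 + 1 : ℕ) : ℤ) - 1) = b 0 := by push_cast; ring
      rw [e3, map_sub, AlternatingMap.sub_apply]
      have : (D.curryLeft (S 0 ((a : ℤ) - 1))) (fun i => R i.succ (ν' i)) = 0 := by
        by_cases h : 0 < l
        · rw [AlternatingMap.curryLeft_apply_apply]
          rw [h2 0 (Fin.succ ⟨0, h⟩) a (by simp)]
          refine D.map_eq_zero_of_eq _ (i := 0) (j := Fin.succ ⟨0, h⟩) ?_ (Fin.succ_ne_zero _).symm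
          simp [ha, h]
        · have : a = 0 := by simp [ha, h]
          rw [this]
          have h30 := h3 0 (by simp; omega)
          simp [h30]
      rw [this, sub_zero]
    rw [Finset.sum_congr rfl key]
    rw [ih (D.curryLeft (S 0 (b 0))) (fun i => R i.succ) (fun i => S i.succ) (fun i x => h1 _ x)
      (fun i j x h => h2 _ _ x (by simp [h])) (fun i h => h3 _ (by simp [h])) (fun i => b i.succ)
      (fun i j h => hb (Fin.succ_le_succ_iff.2 h))]
    rw [AlternatingMap.curryLeft_apply_apply]
    congr 1
    ext i
    refine Fin.cases ?_ (fun i => ?_) i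
    · simp
    · simp
end
open Polynomial

noncomputable section

lemma PSP_eval {l : ℕ} (μ ν : Fin l → ℕ) (x : ℚ) :
    (PSP μ ν).eval x = Matrix.detRowAlternating
      (fun i j => (PSPhi ((ν i : ℤ) - μ j) ((i : ℤ) - j)).eval x) := by
  have := RingHom.map_det (Polynomial.evalRingHom x) (PSM μ ν)
  simp only [PSP]
  exact this

lemma PSP_step {l : ℕ} (μ b : Fin l → ℕ) (hb : Antitone b) (n : ℚ) :
    ∑ ν ∈ (Fintype.piFinset fun i => Finset.range (b i + 1)).filter (fun ν => Antitone ν),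
      (PSP μ ν).eval n = (PSP μ b).eval (n + 1) := by
  have := PS_alt_sum l (Matrix.detRowAlternating (n := Fin l) (R := ℚ))
    (fun i x j => (PSPhi (x - μ j) ((i : ℤ) - j)).eval n)
    (fun i x j => (PSPhi (x - μ j) ((i : ℤ) - j)).eval (n + 1))
    (by
      intro i x; ext j
      simp only [Pi.add_apply]
      rw [PSPhi_R1, show x - 1 - (μ j : ℤ) = x - μ j - 1 by ring])
    (by
      intro i j x h; ext c
      rw [show x - 1 - (μ c : ℤ) = x - μ c - 1 by ring, PSPhi_R2, h]
      congr 2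
      push_cast; ring)
    (by
      intro i hi; ext c
      have := c.2
      rw [PSPhi_of_lt (by omega)]; simp)
    b hb
  simp only [PSP_eval]
  exact this

lemma PS_det_zero {R : Type*} [CommRing R] {l : ℕ} (M : Matrix (Fin l) (Fin l) R) (i : Fin l)
    (h : ∀ a b, i ≤ a → b ≤ i → M a b = 0) : M.det = 0 := by
  rw [Matrix.det_apply]
  apply Finset.sum_eq_zero
  intro σ _
  have : ∃ b, b ≤ i ∧ i ≤ σ b := by
    by_contra! hc
    have h1 : (Finset.Iic i).card ≤ (Finset.Iio i).card := by
      apply Finset.card_le_card_of_injOn σ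
      · intro b hb
        simp only [Finset.coe_Iic, Set.mem_Iic] at hb
        simp only [Finset.coe_Iio, Set.mem_Iio]
        exact hc b hb
      · exact σ.injective.injOn
    simp at h1
  obtain ⟨b, hb, hb'⟩ := this
  have hz : ∏ a, M (σ a) a = 0 :=
    Finset.prod_eq_zero (f := fun a => M (σ a) a) (Finset.mem_univ b) (h _ _ hb' hb)
  rw [hz, smul_zero]

lemma PSP_self {l : ℕ} (μ : Fin l → ℕ) (hμ : Antitone μ) : PSP μ μ = 1 := by
  rw [PSP, Matrix.det_of_isUpperTriangular]
  · simp [PSM, PSPhi_self]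
  · intro i j hij
    simp only [id] at hij
    have := hμ hij.le
    have h2 : (j : ℕ) < i := hij
    simp only [PSM, Matrix.of_apply]
    exact PSPhi_of_lt (by omega)

lemma PSP_zero {l : ℕ} (μ ν : Fin l → ℕ) (hμ : Antitone μ) (hν : Antitone ν) :
    (PSP μ ν).eval 0 = if μ = ν then 1 else 0 := by
  split_ifs with h
  · subst h; simp [PSP_self μ hμ]
  · rw [PSP_eval]
    by_cases hle : ∃ i, ν i < μ i
    · obtain ⟨i, hi⟩ := hle
      refine PS_det_zero _ i ?_
      intro a b ha hb
      have h1 := hν ha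
      have h2 := hμ hb
      have h3 : (i : ℕ) ≤ a := ha
      have h4 : (b : ℕ) ≤ i := hb
      rw [PSPhi_of_lt (by omega)]; simp
    · push Not at hle
      obtain ⟨i, hi⟩ : ∃ i, μ i < ν i := by
        by_contra! hc
        exact h (funext fun i => le_antisymm (hle i) (hc i))
      change Matrix.det (Matrix.of
        (fun i j => (PSPhi ((ν i : ℤ) - μ j) ((i : ℤ) - j)).eval 0)) = 0
      rw [← Matrix.det_transpose]
      refine PS_det_zero _ i ?_
      intro a b ha hb
      have h1 := hν hb
      have h2 := hμ ha
      have h3 : (i : ℕ) ≤ a := ha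
      have h4 : (b : ℕ) ≤ i := hb
      simp only [Matrix.transpose_apply, Matrix.of_apply]
      obtain ⟨Q, hQ, _⟩ := PSPhi_upper ((ν b : ℤ) - μ a) ((b : ℤ) - a) (by omega) (by omega)
      rw [hQ]; simp

/-- Connected case. -/
lemma PSP_connected {l : ℕ} (μ ν : Fin (l + 1) → ℕ) (hμ : Antitone μ) (hν : Antitone ν)
    (h0 : ∀ i, μ i < ν i) (hc : ∀ i : Fin l, μ i.castSucc < ν i.succ) :
    0 ≤ (PSP μ ν).coeff 1 := by
  have hup : ∀ i j : Fin (l + 1), i ≤ j → ∃ Q : ℚ[X],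
      PSPhi ((ν i : ℤ) - μ j) ((i : ℤ) - j) = X * Q ∧
        0 ≤ (-1 : ℚ) ^ ((i : ℤ) - j).natAbs * Q.eval 0 := by
    intro i j hij
    have h1 := hμ hij
    have h2 := h0 i
    have h3 : (i : ℕ) ≤ j := hij
    exact PSPhi_upper _ _ (by omega) (by omega)
  choose Q hQ1 hQ2 using fun j => hup 0 j (Fin.zero_le j)
  have e1 : PSM μ ν = (PSM μ ν).updateRow 0 ((X : ℚ[X]) • Q) := by
    ext i j : 2
    by_cases hi : i = 0
    · subst hi
      simp only [Matrix.updateRow_self, Pi.smul_apply, smul_eq_mul]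
      rw [← hQ1 j]; rfl
    · rw [Matrix.updateRow_ne hi]
  have e2 : (PSP μ ν).coeff 1 = ((PSM μ ν).updateRow 0 Q).det.eval 0 := by
    rw [PSP, e1, Matrix.det_updateRow_smul, Polynomial.coeff_X_mul, Matrix.updateRow_idem,
      Polynomial.coeff_zero_eq_eval_zero]
  rw [e2]
  have e3 := RingHom.map_det (Polynomial.evalRingHom (0 : ℚ)) ((PSM μ ν).updateRow 0 Q)
  rw [Polynomial.coe_evalRingHom] at e3
  rw [e3, Matrix.det_succ_column _ (Fin.last l), Finset.sum_eq_single 0]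
  · rw [Matrix.det_of_isLowerTriangular]
    · have e4 : ∀ i : Fin l, (((Polynomial.evalRingHom (0 : ℚ)).mapMatrix
          ((PSM μ ν).updateRow 0 Q)).submatrix (Fin.succAbove 0) (Fin.succAbove (Fin.last l))) i i
          = 1 := by
        intro i
        simp only [Matrix.submatrix_apply, RingHom.mapMatrix_apply, Matrix.map_apply,
          Fin.zero_succAbove, Fin.succAbove_last]
        rw [Matrix.updateRow_ne (Fin.succ_ne_zero i)]
        simp only [PSM, Matrix.of_apply, coe_evalRingHom]
        have : (((i.succ : Fin (l+1)) : ℕ) : ℤ) - ((i.castSucc : Fin (l+1)) : ℕ) = 1 := by simp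
        rw [this]
        have := hc i
        exact PSPhi_sub _ (by omega)
      rw [Finset.prod_congr rfl (fun i _ => e4 i)]
      have := hQ2 (Fin.last l)
      simp only [RingHom.mapMatrix_apply, Matrix.map_apply, Matrix.updateRow_self]
      simpa using this
    · intro i j hij
      have hij' : (i : ℕ) < j := hij
      simp only [Matrix.submatrix_apply, RingHom.mapMatrix_apply, Matrix.map_apply,
          Fin.zero_succAbove, Fin.succAbove_last]
      rw [Matrix.updateRow_ne (Fin.succ_ne_zero i)]
      simp only [PSM, Matrix.of_apply, coe_evalRingHom]
      obtain ⟨P, hP, _⟩ := hup i.succ j.castSucc (by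
        rw [Fin.le_def]; simp; omega)
      rw [hP]; simp
  · intro i _ hi
    simp only [RingHom.mapMatrix_apply, Matrix.map_apply]
    rw [Matrix.updateRow_ne hi]
    simp only [PSM, Matrix.of_apply, coe_evalRingHom]
    obtain ⟨P, hP, _⟩ := hup i (Fin.last l) (Fin.le_last i)
    rw [hP]; simp
  · simp

lemma PSP_coeff_one {l : ℕ} (μ ν : Fin l → ℕ) (hμ : Antitone μ) (hν : Antitone ν)
    (hle : ∀ i, μ i ≤ ν i) : 0 ≤ (PSP μ ν).coeff 1 := by
  induction l with
  | zero => simp [PSP, Polynomial.coeff_one]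
  | succ l ih =>
    by_cases hfirst : μ 0 = ν 0
    · have : PSP μ ν = PSP (fun i => μ (Fin.succ i)) (fun i => ν (Fin.succ i)) := by
        rw [PSP, Matrix.det_succ_column_zero, Finset.sum_eq_single 0]
        · simp only [PSM, Matrix.of_apply, hfirst]
          simp only [sub_self, PSPhi_self]
          simp only [Fin.val_zero, pow_zero, one_mul, PSP]
          congr 1
          ext i j : 2
          simp [PSM]
        · intro i _ hi
          have h1 := hν (Fin.zero_le i)
          have h2 : 0 < (i : ℕ) := Fin.pos_iff_ne_zero.2 hi
          simp only [PSM, Matrix.of_apply]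
          rw [PSPhi_of_lt (by simp; omega)]; simp
        · simp
      rw [this]
      exact ih _ _ (fun i j h => hμ (Fin.succ_le_succ_iff.2 h))
        (fun i j h => hν (Fin.succ_le_succ_iff.2 h)) (fun i => hle _)
    by_cases hlast : μ (Fin.last l) = ν (Fin.last l)
    · have : PSP μ ν = PSP (fun i => μ (Fin.castSucc i)) (fun i => ν (Fin.castSucc i)) := by
        rw [PSP, Matrix.det_succ_row _ (Fin.last l), Finset.sum_eq_single (Fin.last l)]
        · simp only [PSM, Matrix.of_apply, hlast]
          simp only [sub_self, PSPhi_self]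
          simp only [Fin.val_last, ← two_mul, pow_mul, PSP]
          simp only [even_two, Even.neg_pow, one_pow, one_mul]
          congr 1
          ext i j : 2
          simp [PSM]
        · intro j _ hj
          have h1 := hμ (Fin.le_last j)
          have h2 : (j : ℕ) < l := Fin.val_lt_last hj
          simp only [PSM, Matrix.of_apply]
          rw [PSPhi_of_lt (by simp; omega)]; simp
        · simp
      rw [this]
      exact ih _ _ (fun i j h => hμ (Fin.castSucc_le_castSucc_iff.2 h))
        (fun i j h => hν (Fin.castSucc_le_castSucc_iff.2 h)) (fun i => hle _)
    by_cases hc : ∀ i : Fin l, μ i.castSucc < ν i.succ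
    · refine PSP_connected μ ν hμ hν ?_ hc
      intro i
      refine Fin.lastCases ?_ (fun i => ?_) i
      · exact lt_of_le_of_ne (hle _) hlast
      · exact lt_of_lt_of_le (hc i) (hν (Fin.castSucc_lt_succ).le)
    · push Not at hc
      obtain ⟨c, hc⟩ := hc
      set ν₁ : Fin (l+1) → ℕ := fun i => if i ≤ c.castSucc then ν i else μ i with hν₁
      set ν₂ : Fin (l+1) → ℕ := fun i => if i ≤ c.castSucc then μ i else ν i with hν₂
      have anti1 : Antitone ν₁ := by
        intro i j hij
        simp only [hν₁]
        split_ifs with h1 h2 h2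
        · exact hν hij
        · exact absurd (hij.trans h1) h2
        · exact (hμ hij).trans (hle i)
        · exact hμ hij
      have anti2 : Antitone ν₂ := by
        intro i j hij
        simp only [hν₂]
        split_ifs with h1 h2 h2
        · exact hμ hij
        · exact absurd (hij.trans h1) h2
        · refine (hν ?_).trans (hc.trans (hμ h2))
          rw [not_le, Fin.lt_def] at h1
          rw [Fin.le_def]
          simp at h1 ⊢
          omega
        · exact hν hij
      have block : ∀ ρ : Fin (l+1) → ℕ, Antitone ρ → ρ c.succ ≤ μ c.castSucc →
          ∀ i, ¬ (i ≤ c.castSucc) → ∀ j, j ≤ c.castSucc → PSM μ ρ i j = 0 := by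
        intro ρ hρ hρc i hi j hj
        have h1 : c.succ ≤ i := by
          rw [not_le, Fin.lt_def] at hi
          rw [Fin.le_def]
          simp at hi ⊢
          omega
        have h2 := hρ h1
        have h3 := hμ hj
        have h4 : (j : ℕ) < i := by
          rw [not_le] at hi
          exact lt_of_le_of_lt hj hi
        simp only [PSM, Matrix.of_apply]
        exact PSPhi_of_lt (by omega)
      have hcs : ¬ (c.succ ≤ c.castSucc) := by
        rw [Fin.le_def]; simp
      have hcm : μ c.succ ≤ μ c.castSucc := hμ (Fin.castSucc_lt_succ).le
      have d0 := Matrix.twoBlockTriangular_det (PSM μ ν) (fun i => i ≤ c.castSucc)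
        (block ν hν hc)
      have d1 := Matrix.twoBlockTriangular_det (PSM μ ν₁) (fun i => i ≤ c.castSucc)
        (block ν₁ anti1 (by simp only [hν₁, if_neg hcs]; exact hcm))
      have d2 := Matrix.twoBlockTriangular_det (PSM μ ν₂) (fun i => i ≤ c.castSucc)
        (block ν₂ anti2 (by simp only [hν₂, if_neg hcs]; exact hc))
      have d3 := Matrix.twoBlockTriangular_det (PSM μ μ) (fun i => i ≤ c.castSucc)
        (block μ hμ hcm)
      have b1 : (PSM μ ν₁).toSquareBlockProp (fun i => i ≤ c.castSucc) =
          (PSM μ ν).toSquareBlockProp (fun i => i ≤ c.castSucc) := by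
        ext i j : 2
        simp only [Matrix.toSquareBlockProp_def, Matrix.of_apply, PSM, hν₁, if_pos i.2]
      have b2 : (PSM μ ν₁).toSquareBlockProp (fun i => ¬ i ≤ c.castSucc) =
          (PSM μ μ).toSquareBlockProp (fun i => ¬ i ≤ c.castSucc) := by
        ext i j : 2
        simp only [Matrix.toSquareBlockProp_def, Matrix.of_apply, PSM, hν₁, if_neg i.2]
      have b3 : (PSM μ ν₂).toSquareBlockProp (fun i => i ≤ c.castSucc) =
          (PSM μ μ).toSquareBlockProp (fun i => i ≤ c.castSucc) := by
        ext i j : 2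
        simp only [Matrix.toSquareBlockProp_def, Matrix.of_apply, PSM, hν₂, if_pos i.2]
      have b4 : (PSM μ ν₂).toSquareBlockProp (fun i => ¬ i ≤ c.castSucc) =
          (PSM μ ν).toSquareBlockProp (fun i => ¬ i ≤ c.castSucc) := by
        ext i j : 2
        simp only [Matrix.toSquareBlockProp_def, Matrix.of_apply, PSM, hν₂, if_neg i.2]
      rw [b1, b2] at d1
      rw [b3, b4] at d2
      have d3' : (PSM μ μ).det = 1 := PSP_self μ hμ
      rw [d3'] at d3
      have prod : PSP μ ν = PSP μ ν₁ * PSP μ ν₂ := by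
        simp only [PSP]
        rw [d0, d1, d2]
        linear_combination (((PSM μ ν).toSquareBlockProp (fun i => i ≤ c.castSucc)).det *
          ((PSM μ ν).toSquareBlockProp (fun i => ¬ i ≤ c.castSucc)).det) * d3
      have z1 : (PSP μ ν₁).coeff 0 = 0 := by
        rw [Polynomial.coeff_zero_eq_eval_zero, PSP_zero μ ν₁ hμ anti1, if_neg]
        intro h
        apply hfirst
        have := congrFun h 0
        simpa [hν₁] using this
      have z2 : (PSP μ ν₂).coeff 0 = 0 := by
        rw [Polynomial.coeff_zero_eq_eval_zero, PSP_zero μ ν₂ hμ anti2, if_neg]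
        intro h
        apply hlast
        have := congrFun h (Fin.last l)
        have hh : ¬ (Fin.last l ≤ c.castSucc) := by
          rw [Fin.le_def]; simp
        simpa only [hν₂, if_neg hh] using this
      rw [prod, Polynomial.coeff_mul, Finset.Nat.antidiagonal_succ]
      simp [z1, z2]
end
open Polynomial

noncomputable section

/-- States: antitone sequences of length `k` with entries in `{0, …, m}`. -/
abbrev PSSt (k m : ℕ) : Type := {f : Fin k → Fin (m + 1) // Antitone f}

/-- The underlying sequence of natural numbers. -/
def PSv {k m : ℕ} (μ : PSSt k m) : Fin k → ℕ := fun i => (μ.1 i : ℕ)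

lemma PSv_anti {k m : ℕ} (μ : PSSt k m) : Antitone (PSv μ) := fun _ _ h => μ.2 h

lemma PSv_inj {k m : ℕ} {μ ν : PSSt k m} (h : PSv μ = PSv ν) : μ = ν := by
  apply Subtype.ext
  funext i
  exact Fin.ext (congrFun h i)

lemma PSv_le {k m : ℕ} {μ ν : PSSt k m} : μ ≤ ν ↔ ∀ i, PSv μ i ≤ PSv ν i := Iff.rfl

open Classical in
/-- The zeta matrix. -/
def PSZ (k m : ℕ) : Matrix (PSSt k m) (PSSt k m) ℚ :=
  Matrix.of fun μ ν => if μ ≤ ν then 1 else 0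

lemma PSP_eval_nat {k m : ℕ} (n : ℕ) (μ ν : PSSt k m) :
    (PSP (PSv μ) (PSv ν)).eval (n : ℚ) = (PSZ k m ^ n) μ ν := by
  classical
  induction n generalizing ν with
  | zero =>
    rw [Nat.cast_zero, PSP_zero _ _ (PSv_anti μ) (PSv_anti ν), pow_zero, Matrix.one_apply]
    by_cases h : μ = ν
    · simp [h]
    · rw [if_neg h, if_neg (fun h' => h (PSv_inj h'))]
  | succ n ih =>
    rw [pow_succ, Matrix.mul_apply, Nat.cast_succ, ← PSP_step _ _ (PSv_anti ν)]
    have : ∀ ρ : PSSt k m, (PSZ k m ^ n) μ ρ * PSZ k m ρ ν =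
        if ρ ≤ ν then (PSP (PSv μ) (PSv ρ)).eval (n : ℚ) else 0 := by
      intro ρ
      rw [← ih]
      simp [PSZ]
    simp only [this]
    rw [← Finset.sum_filter]
    symm
    refine Finset.sum_bij (fun ρ _ => PSv ρ) ?_ ?_ ?_ ?_
    · intro ρ hρ
      simp only [Finset.mem_filter, Finset.mem_univ, true_and] at hρ
      simp only [Finset.mem_filter, Fintype.mem_piFinset, Finset.mem_range]
      exact ⟨fun i => Nat.lt_succ_of_le (PSv_le.1 hρ i), PSv_anti ρ⟩
    · intro a _ b _ h
      exact PSv_inj h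
    · intro f hf
      simp only [Finset.mem_filter, Fintype.mem_piFinset, Finset.mem_range] at hf
      have hfm : ∀ i, f i < m + 1 := fun i =>
        lt_of_lt_of_le (hf.1 i) (by have := (ν.1 i).2; simp only [PSv]; omega)
      refine ⟨⟨fun i => ⟨f i, hfm i⟩, fun i j h => hf.2 h⟩, ?_, rfl⟩
      simp only [Finset.mem_filter, Finset.mem_univ, true_and]
      exact PSv_le.2 (fun i => Nat.le_of_lt_succ (hf.1 i))
    · intro a _; rfl

lemma PSZ_pow_zero {k m : ℕ} (n : ℕ) (μ ν : PSSt k m) (h : ¬ μ ≤ ν) :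
    (PSZ k m ^ n) μ ν = 0 := by
  classical
  induction n generalizing ν with
  | zero =>
    rw [pow_zero, Matrix.one_apply, if_neg]
    rintro rfl; exact h le_rfl
  | succ n ih =>
    rw [pow_succ, Matrix.mul_apply]
    apply Finset.sum_eq_zero
    intro ρ _
    by_cases h1 : ρ ≤ ν
    · rw [ih ρ (fun h2 => h (h2.trans h1)), zero_mul]
    · simp [PSZ, h1]

lemma PS_poly_ext (p q : ℚ[X]) (h : ∀ n : ℕ, p.eval (n : ℚ) = q.eval (n : ℚ)) : p = q := by
  refine Polynomial.eq_of_infinite_eval_eq p q ?_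
  refine (Set.infinite_range_of_injective (Nat.cast_injective (R := ℚ))).mono ?_
  rintro _ ⟨n, rfl⟩
  exact h n

lemma PSP_eq_zero {k m : ℕ} (μ ν : PSSt k m) (h : ¬ μ ≤ ν) : PSP (PSv μ) (PSv ν) = 0 := by
  apply PS_poly_ext
  intro n
  rw [PSP_eval_nat, PSZ_pow_zero n μ ν h, eval_zero]

lemma PSP_deriv {k m : ℕ} (μ ν : PSSt k m) :
    derivative (PSP (PSv μ) (PSv ν)) =
      ∑ ρ : PSSt k m, C ((PSP (PSv μ) (PSv ρ)).coeff 1) * PSP (PSv ρ) (PSv ν) := by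
  apply PS_poly_ext
  intro b
  have h1 : (PSP (PSv μ) (PSv ν)).comp (X + C (b : ℚ)) =
      ∑ ρ : PSSt k m, PSP (PSv μ) (PSv ρ) * C ((PSP (PSv ρ) (PSv ν)).eval (b : ℚ)) := by
    apply PS_poly_ext
    intro a
    simp only [eval_comp, eval_add, eval_X, eval_C, eval_finsetSum, eval_mul]
    rw [← Nat.cast_add, PSP_eval_nat, pow_add, Matrix.mul_apply]
    simp only [PSP_eval_nat]
  have h2 := congrArg (fun p => (derivative p).eval 0) h1
  simp only [derivative_comp, eval_mul, eval_comp, derivative_sum, eval_finsetSum,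
    derivative_mul, derivative_C, eval_add, eval_C, eval_X, derivative_add, derivative_X] at h2
  simp only [eval_finsetSum, eval_mul, eval_C]
  have h3 : ∀ p : ℚ[X], (derivative p).eval 0 = p.coeff 1 := by
    intro p
    rw [← Polynomial.coeff_zero_eq_eval_zero, Polynomial.coeff_derivative]
    simp
  simp only [h3] at h2
  simpa using h2

theorem PSP_nonneg {k m : ℕ} (μ ν : PSSt k m) (t : ℕ) : 0 ≤ (PSP (PSv μ) (PSv ν)).coeff t := by
  classical
  have wf : WellFounded (fun a b : PSSt k m => b < a) := wellFounded_gt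
  induction μ using wf.induction generalizing t with
  | _ μ ih =>
    cases t with
    | zero =>
      rw [Polynomial.coeff_zero_eq_eval_zero, PSP_zero _ _ (PSv_anti μ) (PSv_anti ν)]
      split_ifs <;> norm_num
    | succ t =>
      have h := congrArg (fun p => p.coeff t) (PSP_deriv μ ν)
      simp only [coeff_derivative, finsetSum_coeff, coeff_C_mul] at h
      have h2 : 0 ≤ (PSP (PSv μ) (PSv ν)).coeff (t + 1) * ((t : ℚ) + 1) := by
        rw [h]
        apply Finset.sum_nonneg
        intro ρ _
        by_cases hle : μ ≤ ρ
        · rcases hle.eq_or_lt with rfl | hlt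
          · rw [PSP_self _ (PSv_anti μ)]
            simp [Polynomial.coeff_one]
          · exact mul_nonneg (PSP_coeff_one _ _ (PSv_anti μ) (PSv_anti ρ) (PSv_le.1 hle))
              (ih ρ hlt t)
        · rw [PSP_eq_zero μ ρ hle]; simp
      exact nonneg_of_mul_nonneg_left h2 (by positivity)

/-- Membership in the skew shape. -/
def PSin {k m : ℕ} (μ ν : PSSt k m) (i : Fin k) (j : Fin m) : Prop :=
  PSv μ i ≤ (j : ℕ) ∧ (j : ℕ) < PSv ν i

/-- Fillings of a skew shape with entries `< n`. -/
abbrev PSFill {k m : ℕ} (n : ℕ) (μ ν : PSSt k m) : Type :=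
  {f : Fin k → Fin m → ℕ //
    (∀ i j, PSin μ ν i j → f i j < n) ∧ (∀ i j, ¬ PSin μ ν i j → f i j = 0) ∧
    ∀ i j i' j', PSin μ ν i j → PSin μ ν i' j' → i ≤ i' → j ≤ j' → f i j ≤ f i' j'}

instance PSFill_finite {k m : ℕ} (n : ℕ) (μ ν : PSSt k m) : Finite (PSFill n μ ν) := by
  refine Set.Finite.subset (Set.finite_Icc (0 : Fin k → Fin m → ℕ) (fun _ _ => n)) ?_
  rintro f ⟨h1, h2, -⟩
  refine ⟨fun i j => Nat.zero_le _, fun i j => ?_⟩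
  by_cases h : PSin μ ν i j
  · exact (h1 i j h).le
  · rw [h2 i j h]; exact Nat.zero_le _

lemma PS_card_lt {m : ℕ} (p : Fin m → Prop) [DecidablePred p] (hp : ∀ a b, a ≤ b → p b → p a)
    (j : Fin m) : (j : ℕ) < (Finset.univ.filter p).card ↔ p j := by
  constructor
  · intro h
    by_contra hj
    have : Finset.univ.filter p ⊆ Finset.Iio j := by
      intro a ha
      simp only [Finset.mem_filter, Finset.mem_univ, true_and] at ha
      rw [Finset.mem_Iio]
      by_contra hc
      exact hj (hp _ _ (not_lt.1 hc) ha)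
    have := Finset.card_le_card this
    simp at this
    omega
  · intro h
    have : Finset.Iic j ⊆ Finset.univ.filter p := by
      intro a ha
      simp only [Finset.mem_filter, Finset.mem_univ, true_and]
      exact hp _ _ (Finset.mem_Iic.1 ha) h
    have := Finset.card_le_card this
    simp at this
    omega

lemma PS_mkSt {k m : ℕ} (p : Fin k → Fin m → Prop)
    (hp : ∀ i i' j j', i ≤ i' → j ≤ j' → p i' j' → p i j) :
    ∃ μ : PSSt k m, ∀ i (j : Fin m), (j : ℕ) < PSv μ i ↔ p i j := by
  classical
  refine ⟨⟨fun i => ⟨(Finset.univ.filter (p i)).card, ?_⟩, ?_⟩, ?_⟩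
  · have := Finset.card_le_univ (Finset.univ.filter (p i))
    simp only [Fintype.card_fin] at this
    omega
  · intro i i' h
    rw [Fin.le_def]
    change (Finset.univ.filter (p i')).card ≤ (Finset.univ.filter (p i)).card
    apply Finset.card_le_card
    intro j
    simp only [Finset.mem_filter, Finset.mem_univ, true_and]
    exact hp i i' j j h le_rfl
  · intro i j
    exact PS_card_lt (p i) (fun a b h => hp i i a b le_rfl h) j

lemma PSv_bound {k m : ℕ} (μ : PSSt k m) (i : Fin k) : PSv μ i ≤ m := by
  have := (μ.1 i).2
  simp only [PSv]; omega

lemma PS_le_of {k m : ℕ} {μ ν : PSSt k m}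
    (h : ∀ i (j : Fin m), (j : ℕ) < PSv μ i → (j : ℕ) < PSv ν i) : μ ≤ ν := by
  rw [PSv_le]
  intro i
  by_contra hc
  push Not at hc
  have := h i ⟨PSv ν i, lt_of_lt_of_le hc (PSv_bound μ i)⟩ hc
  simp at this

lemma PSFill_card {k m : ℕ} (n : ℕ) (μ ν : PSSt k m) (hle : μ ≤ ν) :
    (Nat.card (PSFill n μ ν) : ℚ) = (PSZ k m ^ n) μ ν := by
  classical
  induction n generalizing ν with
  | zero =>
    rw [pow_zero, Matrix.one_apply]
    split_ifs with h
    · subst h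
      have hin : ∀ i j, ¬ PSin μ μ i j := fun i j h => by
        have := h.1; have := h.2; omega
      have : Unique (PSFill 0 μ μ) :=
        { default := ⟨fun _ _ => 0, fun i j h => absurd h (hin i j), fun _ _ _ => rfl,
            fun _ _ _ _ _ _ _ _ => le_rfl⟩
          uniq := by
            intro f
            apply Subtype.ext
            funext i j
            exact f.2.2.1 i j (hin i j) }
      simp
    · have : IsEmpty (PSFill 0 μ ν) := by
        constructor
        intro f
        apply h
        refine le_antisymm hle (PS_le_of ?_)
        intro i j hj
        by_contra hc
        exact absurd (f.2.1 i j ⟨not_lt.1 hc, hj⟩) (Nat.not_lt_zero _)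
      simp
  | succ n ih =>
    rw [pow_succ, Matrix.mul_apply]
    have ex : ∀ f : PSFill (n + 1) μ ν, ∃ ρ : PSSt k m, ∀ i (j : Fin m),
        (j : ℕ) < PSv ρ i ↔ ((j : ℕ) < PSv ν i ∧ (PSv μ i ≤ j → f.1 i j < n)) := by
      intro f
      apply PS_mkSt
      intro i i' j j' hi hj h
      have hj' : (j : ℕ) ≤ j' := hj
      have hν := PSv_anti ν hi
      have hμ := PSv_anti μ hi
      refine ⟨by omega, fun h3 => ?_⟩
      have h4 := h.2 (by omega)
      refine lt_of_le_of_lt (f.2.2.2 i j i' j' ⟨h3, by omega⟩ ⟨by omega, h.1⟩ hi hj) h4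
    choose T hT using ex
    rw [Nat.card_congr (Equiv.sigmaFiberEquiv T).symm, Nat.card_sigma, Nat.cast_sum]
    apply Finset.sum_congr rfl
    intro ρ _
    by_cases h2 : ρ ≤ ν
    swap
    · have : IsEmpty {f // T f = ρ} := by
        constructor
        rintro ⟨f, rfl⟩
        exact h2 (PS_le_of fun i j hj => ((hT f i j).1 hj).1)
      simp [PSZ, h2]
    by_cases h1 : μ ≤ ρ
    swap
    · have : IsEmpty {f // T f = ρ} := by
        constructor
        rintro ⟨f, rfl⟩
        refine h1 (PS_le_of fun i j hj => (hT f i j).2 ⟨lt_of_lt_of_le hj (PSv_le.1 hle i), ?_⟩)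
        intro h; omega
      simp [PSZ_pow_zero n μ ρ h1]
    rw [← ih ρ h1]
    have : PSZ k m ρ ν = 1 := by simp [PSZ, h2]
    rw [this, mul_one]
    congr 1
    have ρν := PSv_le.1 h2
    have μρ := PSv_le.1 h1
    refine Nat.card_congr
      { toFun := fun f => ⟨fun i j => if PSin μ ρ i j then f.1.1 i j else 0, ?_, ?_, ?_⟩
        invFun := fun g => ⟨⟨fun i j => if PSin ρ ν i j then n else g.1 i j, ?_, ?_, ?_⟩, ?_⟩
        left_inv := ?_
        right_inv := ?_ }
    · intro i j h
      beta_reduce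
      rw [if_pos h]
      have := (hT f.1 i j)
      rw [f.2] at this
      exact (this.1 h.2).2 h.1
    · intro i j h
      beta_reduce
      rw [if_neg h]
    · intro i j i' j' h h' hi hj
      beta_reduce
      rw [if_pos h, if_pos h']
      exact f.1.2.2.2 i j i' j' ⟨h.1, lt_of_lt_of_le h.2 (ρν i)⟩
        ⟨h'.1, lt_of_lt_of_le h'.2 (ρν i')⟩ hi hj
    · intro i j h
      show (if PSin ρ ν i j then n else g.1 i j) < n + 1
      split_ifs with h3
      · omega
      · have : PSin μ ρ i j := ⟨h.1, by
          by_contra hc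
          exact h3 ⟨not_lt.1 hc, h.2⟩⟩
        have := g.2.1 i j this
        omega
    · intro i j h
      show (if PSin ρ ν i j then n else g.1 i j) = 0
      rw [if_neg (fun h3 => h ⟨(μρ i).trans h3.1, h3.2⟩)]
      exact g.2.2.1 i j (fun h3 => h ⟨h3.1, lt_of_lt_of_le h3.2 (ρν i)⟩)
    · intro i j i' j' h h' hi hj
      show (if PSin ρ ν i j then n else g.1 i j) ≤ (if PSin ρ ν i' j' then n else g.1 i' j')
      have hj' : (j : ℕ) ≤ j' := hj
      by_cases h3 : PSin ρ ν i' j'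
      · rw [if_pos h3]
        split_ifs with h4
        · exact le_rfl
        · have : PSin μ ρ i j := ⟨h.1, by
            by_contra hc
            exact h4 ⟨not_lt.1 hc, h.2⟩⟩
          exact (g.2.1 i j this).le
      · rw [if_neg h3]
        have h5 : PSin μ ρ i' j' := ⟨h'.1, by
            by_contra hc
            exact h3 ⟨not_lt.1 hc, h'.2⟩⟩
        have h6 : (j : ℕ) < PSv ρ i := lt_of_le_of_lt hj' (lt_of_lt_of_le h5.2 (PSv_anti ρ hi))
        rw [if_neg (fun h7 => by have := h7.1; omega)]
        exact g.2.2.2 i j i' j' ⟨h.1, h6⟩ h5 hi hj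
    · apply le_antisymm
      · apply PS_le_of
        intro i j hj
        rw [hT] at hj
        obtain ⟨h3, h4⟩ := hj
        by_contra hc
        have h5 := h4 ((μρ i).trans (not_lt.1 hc))
        change (if PSin ρ ν i j then n else g.1 i j) < n at h5
        rw [if_pos ⟨not_lt.1 hc, h3⟩] at h5
        omega
      · apply PS_le_of
        intro i j hj
        rw [hT]
        refine ⟨lt_of_lt_of_le hj (ρν i), fun h3 => ?_⟩
        change (if PSin ρ ν i j then n else g.1 i j) < n
        rw [if_neg (fun h7 => by have := h7.1; omega)]
        exact g.2.1 i j ⟨h3, hj⟩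
    · rintro ⟨f, hf⟩
      apply Subtype.ext
      apply Subtype.ext
      funext i j
      show (if PSin ρ ν i j then n else if PSin μ ρ i j then f.1 i j else 0) = f.1 i j
      have hTf := hT f i j
      rw [hf] at hTf
      split_ifs with h3 h4
      · have h5 := f.2.1 i j ⟨(μρ i).trans h3.1, h3.2⟩
        have h6 : ¬ f.1 i j < n := fun hlt => by
          have := hTf.2 ⟨h3.2, fun _ => hlt⟩
          have := h3.1
          omega
        omega
      · rfl
      · symm
        apply f.2.2.1
        intro h5
        by_cases h6 : (j : ℕ) < PSv ρ i
        · exact h4 ⟨h5.1, h6⟩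
        · exact h3 ⟨not_lt.1 h6, h5.2⟩
    · intro g
      apply Subtype.ext
      funext i j
      show (if PSin μ ρ i j then (if PSin ρ ν i j then n else g.1 i j) else 0) = g.1 i j
      split_ifs with h3 h4
      · have := h3.2; have := h4.1; omega
      · rfl
      · exact (g.2.2.1 i j h3).symm

theorem PSFill_poly {k m : ℕ} (n : ℕ) (μ ν : PSSt k m) (hle : μ ≤ ν) :
    (PSP (PSv μ) (PSv ν)).eval (n : ℚ) = Nat.card (PSFill n μ ν) := by
  rw [PSP_eval_nat, PSFill_card n μ ν hle]
end
open Polynomial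

noncomputable section

/-- Lattice points, reformulated. -/
abbrev PSX {k m : ℕ} (Y Z : Fin k → ℕ) (n : ℕ) : Type :=
  {x : Fin k → Fin m → ℤ //
    (∀ i i' j j', i ≤ i' → j ≤ j' → x i j ≤ x i' j') ∧
    ∀ i j, (n : ℤ) * (Z i : ℤ) ≤ x i j ∧ x i j ≤ (n : ℤ) * (Y i : ℤ)}

instance PSX_finite {k m : ℕ} (Y Z : Fin k → ℕ) (n : ℕ) : Finite (PSX (m := m) Y Z n) := by
  refine Set.Finite.subset (Set.finite_Icc (fun (i : Fin k) (_ : Fin m) => (n : ℤ) * (Z i : ℤ))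
    (fun i _ => (n : ℤ) * (Y i : ℤ))) ?_
  rintro x ⟨-, h⟩
  exact ⟨fun i j => (h i j).1, fun i j => (h i j).2⟩

/-- Admissible integer parts. -/
def PSgood {k m T : ℕ} (Y Z : Fin k → ℕ) (q : Fin k → Fin m → Fin (T + 1)) : Prop :=
  (∀ i i' j j', i ≤ i' → j ≤ j' → q i j ≤ q i' j') ∧
    ∀ i j, Z i ≤ (q i j : ℕ) ∧ (q i j : ℕ) ≤ Y i

lemma PS_fiber {k m T : ℕ} (Y Z : Fin k → ℕ) (hY : Monotone Y)
    (q : Fin k → Fin m → Fin (T + 1)) (hq : PSgood Y Z q) :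
    ∃ p : ℚ[X], (∀ t, 0 ≤ p.coeff t) ∧ ∀ n : ℕ, 1 ≤ n →
      p.eval (n : ℚ) = Nat.card {x : PSX (m := m) Y Z n //
        ∀ i j, x.1 i j / (n : ℤ) = ((q i j : ℕ) : ℤ)} := by
  classical
  obtain ⟨hq1, hq2⟩ := hq
  have exμ : ∀ t : Fin (T + 1), ∃ μ : PSSt k m, ∀ i (j : Fin m),
      (j : ℕ) < PSv μ i ↔ (Y i ≤ t ∨ q i j < t) := by
    intro t
    apply PS_mkSt
    rintro i i' j j' hi hj (h | h)
    · exact Or.inl ((hY hi).trans h)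
    · exact Or.inr (lt_of_le_of_lt (hq1 _ _ _ _ hi hj) h)
  have exν : ∀ t : Fin (T + 1), ∃ μ : PSSt k m, ∀ i (j : Fin m),
      (j : ℕ) < PSv μ i ↔ q i j ≤ t := by
    intro t
    apply PS_mkSt
    intro i i' j j' hi hj h
    exact (hq1 _ _ _ _ hi hj).trans h
  choose μ hμ using exμ
  choose ν hν using exν
  have hin : ∀ t i j, PSin (μ t) (ν t) i j ↔ (q i j = t ∧ (t : ℕ) < Y i) := by
    intro t i j
    rw [PSin, hν, ← not_lt, hμ, not_or, not_le, not_lt]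
    constructor
    · rintro ⟨⟨a, b⟩, c⟩; exact ⟨le_antisymm c b, a⟩
    · rintro ⟨a, b⟩; exact ⟨⟨b, a.ge⟩, a.le⟩
  have hle : ∀ t, μ t ≤ ν t := by
    intro t
    apply PS_le_of
    intro i j
    rw [hμ, hν]
    rintro (h | h)
    · exact Fin.le_def.2 ((hq2 i j).2.trans h)
    · exact h.le
  refine ⟨∏ t, PSP (PSv (μ t)) (PSv (ν t)), ?_, ?_⟩
  · have : ∀ s : Finset (Fin (T + 1)), ∀ t, 0 ≤ (∏ t ∈ s, PSP (PSv (μ t)) (PSv (ν t))).coeff t := by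
      intro s
      induction s using Finset.induction_on with
      | empty =>
        intro t
        rw [Finset.prod_empty, Polynomial.coeff_one]
        split_ifs <;> norm_num
      | insert a s ha ih =>
        intro t
        rw [Finset.prod_insert ha, Polynomial.coeff_mul]
        exact Finset.sum_nonneg fun x _ => mul_nonneg (PSP_nonneg _ _ _) (ih _)
    exact this _
  · intro n hn
    rw [eval_prod, Finset.prod_congr rfl (fun t _ => PSFill_poly n (μ t) (ν t) (hle t)),
      ← Nat.cast_prod, ← Nat.card_pi]
    congr 1
    symm
    have hn0 : (0 : ℤ) < n := by exact_mod_cast hn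
    -- bounds of the fractional part
    have hf : ∀ (g : (t : Fin (T + 1)) → PSFill n (μ t) (ν t)) (i : Fin k) (j : Fin m),
        (g (q i j)).1 i j < n := by
      intro g i j
      by_cases h : PSin (μ (q i j)) (ν (q i j)) i j
      · exact (g (q i j)).2.1 i j h
      · rw [(g (q i j)).2.2.1 i j h]; exact hn
    have hf0 : ∀ (g : (t : Fin (T + 1)) → PSFill n (μ t) (ν t)) (i : Fin k) (j : Fin m),
        (q i j : ℕ) = Y i → (g (q i j)).1 i j = 0 := by
      intro g i j h
      apply (g (q i j)).2.2.1 i j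
      rw [hin]
      rintro ⟨-, h2⟩
      omega
    have hx : ∀ x : {x : PSX (m := m) Y Z n // ∀ i j, x.1 i j / (n : ℤ) = ((q i j : ℕ) : ℤ)},
        ∀ i j, 0 ≤ x.1.1 i j - n * (q i j : ℕ) ∧ x.1.1 i j - n * (q i j : ℕ) < n := by
      intro x i j
      rw [← x.2 i j]
      have h1 := Int.mul_ediv_add_emod (x.1.1 i j) n
      have h2 := Int.emod_nonneg (x.1.1 i j) hn0.ne'
      have h3 := Int.emod_lt_of_pos (x.1.1 i j) hn0
      omega
    refine Nat.card_congr
      { toFun := fun x t => ⟨fun i j =>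
          if q i j = t ∧ (t : ℕ) < Y i then (x.1.1 i j - n * (q i j : ℕ)).toNat else 0, ?_, ?_, ?_⟩
        invFun := fun g => ⟨⟨fun i j => (n : ℤ) * (q i j : ℕ) + ((g (q i j)).1 i j : ℕ), ?_, ?_⟩, ?_⟩
        left_inv := ?_
        right_inv := ?_ }
    · intro i j h
      rw [hin] at h
      beta_reduce
      rw [if_pos h]
      have := hx x i j
      omega
    · intro i j h
      rw [hin] at h
      beta_reduce
      rw [if_neg h]
    · intro i j i' j' h h' hi hj
      rw [hin] at h h'
      beta_reduce
      rw [if_pos h, if_pos h', h.1, h'.1]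
      have := x.1.2.1 i i' j j' hi hj
      exact Int.toNat_le_toNat (by linarith)
    · intro i i' j j' hi hj
      beta_reduce
      have h1 := hq1 i i' j j' hi hj
      rcases h1.eq_or_lt with h2 | h2
      · have hYi := hY hi
        have : (g (q i j)).1 i j ≤ (g (q i' j')).1 i' j' := by
          by_cases h3 : (q i j : ℕ) = Y i
          · rw [hf0 g i j h3]; exact Nat.zero_le _
          · have h4 : (q i j : ℕ) < Y i := lt_of_le_of_ne (hq2 i j).2 h3
            rw [← h2]
            refine (g (q i j)).2.2.2 i j i' j' ?_ ?_ hi hj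
            · rw [hin]; exact ⟨rfl, h4⟩
            · rw [hin]; exact ⟨h2.symm, by omega⟩
        have h5 : ((q i j : ℕ)) = (q i' j' : ℕ) := by rw [h2]
        rw [h5]
        have : (((g (q i j)).1 i j : ℕ) : ℤ) ≤ ((g (q i' j')).1 i' j' : ℕ) := by exact_mod_cast this
        linarith
      · have h3 : ((q i j : ℕ) : ℤ) + 1 ≤ ((q i' j' : ℕ) : ℤ) := by
          have : (q i j : ℕ) < (q i' j' : ℕ) := h2
          omega
        have h4 : (((g (q i j)).1 i j : ℕ) : ℤ) < n := by exact_mod_cast hf g i j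
        have h5 : (0 : ℤ) ≤ ((g (q i' j')).1 i' j' : ℕ) := by positivity
        nlinarith
    · intro i j
      beta_reduce
      obtain ⟨h1, h2⟩ := hq2 i j
      have h4 : (((g (q i j)).1 i j : ℕ) : ℤ) < n := by exact_mod_cast hf g i j
      have h5 : (0 : ℤ) ≤ ((g (q i j)).1 i j : ℕ) := by positivity
      have h1' : (Z i : ℤ) ≤ (q i j : ℕ) := by exact_mod_cast h1
      refine ⟨by nlinarith, ?_⟩
      rcases h2.eq_or_lt with h3 | h3
      · rw [hf0 g i j h3, h3]; simp
      · have h3' : ((q i j : ℕ) : ℤ) + 1 ≤ Y i := by exact_mod_cast h3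
        nlinarith
    · intro i j
      have h4 : (((g (q i j)).1 i j : ℕ) : ℤ) < n := by exact_mod_cast hf g i j
      have h5 : (0 : ℤ) ≤ ((g (q i j)).1 i j : ℕ) := by positivity
      show ((n : ℤ) * (q i j : ℕ) + ((g (q i j)).1 i j : ℕ)) / (n : ℤ) = _
      rw [Int.mul_add_ediv_left _ _ hn0.ne', Int.ediv_eq_zero_of_lt h5 h4, add_zero]
    · intro x
      apply Subtype.ext
      apply Subtype.ext
      funext i j
      show (n : ℤ) * (q i j : ℕ) + ((if q i j = q i j ∧ (q i j : ℕ) < Y i then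
        (x.1.1 i j - n * (q i j : ℕ)).toNat else 0 : ℕ) : ℤ) = x.1.1 i j
      have h1 := hx x i j
      by_cases h : (q i j : ℕ) < Y i
      · rw [if_pos ⟨rfl, h⟩]
        omega
      · rw [if_neg (fun h' => h h'.2)]
        have h3 : (q i j : ℕ) = Y i := le_antisymm (hq2 i j).2 (not_lt.1 h)
        have h4 := (x.1.2.2 i j).2
        rw [h3] at h1 ⊢
        push_cast
        linarith
    · intro g
      funext t
      apply Subtype.ext
      funext i j
      show (if q i j = t ∧ (t : ℕ) < Y i then
        ((n : ℤ) * (q i j : ℕ) + ((g (q i j)).1 i j : ℕ) - n * (q i j : ℕ)).toNat else 0) = (g t).1 i j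
      split_ifs with h
      · obtain ⟨rfl, h⟩ := h
        simp
      · symm
        apply (g t).2.2.1
        rw [hin]; exact h

theorem PS_main {k m : ℕ} (Y Z : Fin k → ℕ) (hY : Monotone Y) :
    ∃ p : ℚ[X], (∀ t, 0 ≤ p.coeff t) ∧ ∀ n : ℕ, 1 ≤ n →
      p.eval (n : ℚ) = Nat.card (PSX (m := m) Y Z n) := by
  classical
  set T := ∑ i, Y i with hT
  have hYT : ∀ i, Y i ≤ T := fun i =>
    Finset.single_le_sum (f := Y) (fun _ _ => Nat.zero_le _) (Finset.mem_univ i)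
  have ex : ∀ q : Fin k → Fin m → Fin (T + 1), ∃ p : ℚ[X], (∀ t, 0 ≤ p.coeff t) ∧
      ∀ n : ℕ, 1 ≤ n → p.eval (n : ℚ) = Nat.card {x : PSX (m := m) Y Z n //
        ∀ i j, x.1 i j / (n : ℤ) = ((q i j : ℕ) : ℤ)} := by
    intro q
    by_cases hq : PSgood Y Z q
    · exact PS_fiber Y Z hY q hq
    · refine ⟨0, by simp, fun n hn => ?_⟩
      have hn0 : (0 : ℤ) < n := by exact_mod_cast hn
      have : IsEmpty {x : PSX (m := m) Y Z n // ∀ i j, x.1 i j / (n : ℤ) = ((q i j : ℕ) : ℤ)} := by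
        constructor
        rintro ⟨x, hx⟩
        apply hq
        refine ⟨fun i i' j j' hi hj => ?_, fun i j => ⟨?_, ?_⟩⟩
        · have h1 := Int.ediv_le_ediv hn0 (x.2.1 i i' j j' hi hj)
          rw [hx, hx] at h1
          exact Fin.le_def.2 (by exact_mod_cast h1)
        · have h1 := Int.ediv_le_ediv hn0 (x.2.2 i j).1
          rw [hx, Int.mul_ediv_cancel_left _ hn0.ne'] at h1
          exact_mod_cast h1
        · have h1 := Int.ediv_le_ediv hn0 (x.2.2 i j).2
          rw [hx, Int.mul_ediv_cancel_left _ hn0.ne'] at h1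
          exact_mod_cast h1
      simp
  choose p hp1 hp2 using ex
  refine ⟨∑ q, p q, fun t => ?_, fun n hn => ?_⟩
  · rw [finsetSum_coeff]
    exact Finset.sum_nonneg fun q _ => hp1 q t
  · have hn0 : (0 : ℤ) < n := by exact_mod_cast hn
    rw [eval_finsetSum]
    have exq : ∀ x : PSX (m := m) Y Z n, ∃ q : Fin k → Fin m → Fin (T + 1),
        ∀ i j, x.1 i j / (n : ℤ) = ((q i j : ℕ) : ℤ) := by
      intro x
      have h0 : ∀ i j, 0 ≤ x.1 i j / (n : ℤ) := by
        intro i j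
        apply Int.ediv_nonneg _ hn0.le
        exact le_trans (by positivity) (x.2.2 i j).1
      refine ⟨fun i j => ⟨(x.1 i j / (n : ℤ)).toNat, ?_⟩, fun i j => ?_⟩
      · have h1 := Int.ediv_le_ediv hn0 (x.2.2 i j).2
        rw [Int.mul_ediv_cancel_left _ hn0.ne'] at h1
        have := hYT i
        omega
      · have := h0 i j
        simp only
        omega
    choose Q hQ using exq
    rw [Nat.card_congr (Equiv.sigmaFiberEquiv Q).symm, Nat.card_sigma, Nat.cast_sum]
    apply Finset.sum_congr rfl
    intro q _
    rw [hp2 q n hn]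
    congr 1
    apply Nat.card_congr
    apply Equiv.subtypeEquivRight
    intro x
    constructor
    · intro h
      funext i j
      apply Fin.ext
      have := (hQ x i j).symm.trans (h i j)
      exact_mod_cast this
    · rintro rfl
      exact hQ x

end

theorem pitmanStanley_ehrhart_positivity
    (k m : ℕ) (hk : 0 < k) (hm : 0 < m) (y z : Fin k → ℕ) :
    ∃ p : Polynomial ℚ, (∀ i : ℕ, 0 ≤ p.coeff i) ∧
      ∀ n : ℕ, 1 ≤ n →
        p.eval (n : ℚ) =
          Nat.card {x : Fin k → Fin m → ℤ //
            (∀ i : Fin k, Monotone (x i)) ∧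
            (∀ (i : Fin k) (j : Fin m),
              (n : ℤ) * ∑ l ∈ Finset.Iic i, (z l : ℤ) ≤ x i j ∧
              x i j ≤ (n : ℤ) * ∑ l ∈ Finset.Iic i, (y l : ℤ)) ∧
            (∀ (i : Fin k) (hi : (i : ℕ) + 1 < k) (j : Fin m),
              x i j ≤ x ⟨(i : ℕ) + 1, hi⟩ j)} := by
  obtain ⟨p, hp1, hp2⟩ := PS_main (m := m) (fun i : Fin k => ∑ l ∈ Finset.Iic i, y l)
    (fun i => ∑ l ∈ Finset.Iic i, z l) (by
      intro i j h
      exact Finset.sum_le_sum_of_subset (Finset.Iic_subset_Iic.2 h))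
  refine ⟨p, hp1, fun n hn => ?_⟩
  rw [hp2 n hn]
  congr 1
  apply Nat.card_congr
  apply Equiv.subtypeEquivRight
  intro x
  push_cast
  constructor
  · rintro ⟨h1, h2⟩
    refine ⟨fun i j j' h => h1 i i j j' le_rfl h, h2, fun i hi j => h1 _ _ _ _ ?_ le_rfl⟩
    rw [Fin.le_def]; simp
  · rintro ⟨h1, h2, h3⟩
    refine ⟨fun i i' j j' hi hj => ?_, h2⟩
    refine le_trans ?_ (h1 i' hj)
    have key : ∀ (d : ℕ) (h : (i : ℕ) + d < k), x i j ≤ x ⟨(i : ℕ) + d, h⟩ j := by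
      intro d
      induction d with
      | zero => intro h; exact le_rfl
      | succ d ih =>
        intro h
        exact (ih (by omega)).trans (h3 ⟨(i : ℕ) + d, by omega⟩ h j)
    have hi' : (i : ℕ) ≤ i' := hi
    have := key ((i' : ℕ) - i) (by omega)
    have e : (⟨(i : ℕ) + ((i' : ℕ) - i), by omega⟩ : Fin k) = i' := Fin.ext (by simp; omega)
    rwa [e] at this
end

section
/- For any k ≥ 1 and m ≥ 1, there exists a polynomial f ∈ ℚ[y_1, …, y_k] all of whose coefficients are nonnegative such that for every y ∈ ℤ_{≥0}^k, f(y_1, …, y_k) equals the number of integer points (x_{i,j}) ∈ ℤ^{km} satisfying 0 ≤ x_{i,1} ≤ x_{i,2} ≤ ⋯ ≤ x_{i,m} ≤ ỹ_i for all i ∈ [k] and x_{i,j} ≤ x_{i+1,j} for all i ∈ [k−1], j ∈ [m], i.e. f(y) = #(PS_k^m(y, 0) ∩ ℤ^{km}). -/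
namespace PSPos
open Finset

/-- polynomial multichoose, extended by zero to negative lower index -/
noncomputable def hq (x : ℚ) (c : ℤ) : ℚ :=
  if c < 0 then 0 else (∏ s ∈ range c.toNat, (x + s)) / (c.toNat.factorial : ℚ)

lemma hq_neg (x : ℚ) {c : ℤ} (h : c < 0) : hq x c = 0 := by simp [hq, h]

lemma hq_nat (x : ℚ) (c : ℕ) : hq x c = (∏ s ∈ range c, (x + s)) / (c.factorial : ℚ) := by
  simp [hq]

lemma hq_pascal (x : ℚ) (c : ℤ) : hq x c = hq x (c - 1) + hq (x - 1) c := by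
  rcases lt_or_ge c 0 with h | h
  · rw [hq_neg _ h, hq_neg _ h, hq_neg _ (by omega)]; simp
  · lift c to ℕ using h
    cases c with
    | zero => rw [hq_neg x (c := ((0:ℕ):ℤ) - 1) (by simp), hq_nat, hq_nat]; simp
    | succ n =>
      have e : (((n + 1 : ℕ) : ℤ) - 1) = (n : ℤ) := by push_cast; ring
      rw [e, hq_nat, hq_nat, hq_nat, prod_range_succ, prod_range_succ' (fun s : ℕ => x - 1 + (s:ℚ))]
      have e2 : ∏ s ∈ range n, (x - 1 + ((s + 1 : ℕ) : ℚ)) = ∏ s ∈ range n, (x + s) :=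
        prod_congr rfl (fun s _ => by push_cast; ring)
      rw [e2, Nat.factorial_succ]
      have : (n.factorial : ℚ) ≠ 0 := by exact_mod_cast n.factorial_ne_zero
      push_cast
      field_simp
      ring

/-- vanishing at nonpositive integers -/
lemma hq_zero (d : ℕ) {c : ℤ} (h : (d : ℤ) < c) : hq (-(d : ℚ)) c = 0 := by
  lift c to ℕ using by omega
  rw [hq_nat, prod_eq_zero (i := d) (by simp; omega) (by simp)]; simp

lemma hq_one {c : ℤ} (h : 0 ≤ c) : hq 1 c = 1 := by
  lift c to ℕ using h
  rw [hq_nat]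
  have : ∏ s ∈ range c, ((1 : ℚ) + s) = c.factorial := by
    rw [← prod_range_add_one_eq_factorial]; push_cast
    exact prod_congr rfl (fun s _ => by ring)
  rw [this, div_self]; exact_mod_cast c.factorial_ne_zero

lemma hq_c0 (x : ℚ) : hq x 0 = 1 := by simp [hq]

variable {k : ℕ}

noncomputable def GM (μ ν : Fin k → ℤ) (t : Fin k → ℚ) : Matrix (Fin k) (Fin k) ℚ :=
  Matrix.of fun i j => hq (t i + (i : ℕ) - (j : ℕ)) (ν i - μ j + (j : ℕ) - (i : ℕ))

lemma gstep (μ ν : Fin k → ℤ) (t : Fin k → ℚ) (r : Fin k) :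
    (GM μ ν t).det = (GM μ (Function.update ν r (ν r - 1)) t).det +
      (GM μ ν (Function.update t r (t r - 1))).det := by
  have h1 : GM μ ν t = (GM μ ν t).updateRow r
      ((GM μ (Function.update ν r (ν r - 1)) t) r + (GM μ ν (Function.update t r (t r - 1))) r) := by
    ext i j
    by_cases hi : i = r
    · subst hi
      simp only [Matrix.updateRow_self, Pi.add_apply, GM, Matrix.of_apply, Function.update_self]
      rw [hq_pascal]
      congr 1
      · congr 1; ring
      · congr 1; ring
    · simp [Matrix.updateRow_ne hi]
  rw [h1, Matrix.det_updateRow_add]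
  congr 2
  · ext i j
    by_cases hi : i = r
    · subst hi; simp
    · simp [Matrix.updateRow_ne hi, GM, Function.update_of_ne hi]
  · ext i j
    by_cases hi : i = r
    · subst hi; simp
    · simp [Matrix.updateRow_ne hi, GM, Function.update_of_ne hi]

lemma geq (μ ν : Fin k → ℤ) (t : Fin k → ℚ) (r r' : Fin k) (hr : (r' : ℕ) = r + 1)
    (hν : ν r + 1 = ν r') (ht : t r = t r' + 1) : (GM μ ν t).det = 0 := by
  apply Matrix.det_zero_of_row_eq (i := r) (j := r') (by intro h; subst h; omega)
  ext j
  simp only [GM, Matrix.of_apply]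
  congr 1
  · rw [ht, hr]; push_cast; ring
  · rw [← hν, hr]; push_cast; ring

lemma glast (μ ν : Fin k → ℤ) (t : Fin k → ℚ) (r : Fin k) (hr : (r : ℕ) + 1 = k)
    (hν : ν r < 0) (hμ : ∀ j, 0 ≤ μ j) : (GM μ ν t).det = 0 := by
  apply Matrix.det_eq_zero_of_row_eq_zero r
  intro j
  simp only [GM, Matrix.of_apply]
  apply hq_neg
  have := hμ j
  omega

/-- antitone vectors below `ν` -/
noncomputable def P (ν : Fin k → ℕ) : Finset (Fin k → ℕ) := by
  classical exact (Finset.Iic ν).filter Antitone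

lemma mem_P {κ ν : Fin k → ℕ} : κ ∈ P ν ↔ κ ≤ ν ∧ Antitone κ := by simp [P]

noncomputable def Q (r : ℕ) (ν : Fin k → ℕ) : Finset (Fin k → ℕ) := by
  classical exact (P ν).filter (fun κ => ∀ i : Fin k, r ≤ i → κ i = ν i)

lemma mem_Q {r : ℕ} {κ ν : Fin k → ℕ} :
    κ ∈ Q r ν ↔ (κ ≤ ν ∧ Antitone κ) ∧ ∀ i : Fin k, r ≤ i → κ i = ν i := by simp [Q, mem_P]

def cz (ν : Fin k → ℕ) : Fin k → ℤ := fun i => ν i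

lemma antitone_update {ν : Fin k → ℕ} (hν : Antitone ν) (r : Fin k) (v : ℕ) (h1 : v ≤ ν r)
    (h2 : ∀ r' : Fin k, r < r' → ν r' ≤ v) : Antitone (Function.update ν r v) := by
  intro a b hab
  by_cases ha : a = r <;> by_cases hb : b = r
  · subst ha; subst hb; simp
  · subst ha; simp only [Function.update_self, Function.update_of_ne hb]
    exact h2 b (lt_of_le_of_ne hab (Ne.symm hb))
  · subst hb; simp only [Function.update_self, Function.update_of_ne ha]
    exact h1.trans (hν hab)
  · simp only [Function.update_of_ne hb, Function.update_of_ne ha]; exact hν hab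

lemma sumstep (μ : Fin k → ℕ) (n : ℚ) (r : ℕ) (hr : r ≤ k) : ∀ ν : Fin k → ℕ, Antitone ν →
    ∑ κ ∈ Q r ν, (GM (cz μ) (cz κ) (fun _ => n)).det =
      (GM (cz μ) (cz ν) (fun i => if (i : ℕ) < r then n + 1 else n)).det := by
  induction r with
  | zero =>
    intro ν hν
    have : Q 0 ν = {ν} := by
      ext κ
      rw [mem_Q, mem_singleton]
      constructor
      · intro h; ext i; exact h.2 i (Nat.zero_le _)
      · rintro rfl; exact ⟨⟨le_rfl, hν⟩, fun _ _ => rfl⟩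
    rw [this]; simp
  | succ r ih =>
    have hrk : r < k := hr
    set R : Fin k := ⟨r, hrk⟩ with hR
    have key : ∀ v : ℕ, ∀ ν : Fin k → ℕ, Antitone ν → ν R = v →
      ∑ κ ∈ Q (r+1) ν, (GM (cz μ) (cz κ) (fun _ => n)).det =
      (GM (cz μ) (cz ν) (fun i => if (i : ℕ) < r + 1 then n + 1 else n)).det := by
      intro v
      induction v with
      | zero =>
        intro ν hν hv
        have hQ : Q (r+1) ν = Q r ν := by
          ext κ
          rw [mem_Q, mem_Q]
          constructor
          · rintro ⟨h1, h2⟩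
            refine ⟨h1, fun i hi => ?_⟩
            by_cases hir : i = R
            · have h9 : κ R ≤ ν R := h1.1 R
              rw [hir]; omega
            · exact h2 i (by have : (i:ℕ) ≠ r := fun h => hir (Fin.ext h)
                             omega)
          · rintro ⟨h1, h2⟩; exact ⟨h1, fun i hi => h2 i (by omega)⟩
        rw [hQ, ih hrk.le ν hν, gstep _ (cz ν) (fun i : Fin k => if (i : ℕ) < r + 1 then n + 1 else n) R]
        have z : (GM (cz μ) (Function.update (cz ν) R (cz ν R - 1))
            (fun i => if (i : ℕ) < r + 1 then n + 1 else n)).det = 0 := by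
          by_cases hl : r + 1 < k
          · apply geq _ _ _ R ⟨r+1, hl⟩ rfl
            · have h0 : ν ⟨r+1, hl⟩ ≤ ν R := hν (by simp [hR, Fin.le_def])
              rw [Function.update_self, Function.update_of_ne (by simp [hR])]
              simp only [cz]; omega
            · simp [hR]
          · apply glast _ _ _ R (by simp [hR]; omega)
            · simp [cz, hv]
            · intro j; simp [cz]
        rw [z, zero_add]
        congr 2
        ext i
        by_cases hir : i = R
        · subst hir; simp [hR]
        · rw [Function.update_of_ne hir]
          have : (i:ℕ) ≠ r := fun h => hir (Fin.ext h)
          have e : (i:ℕ) < r + 1 ↔ (i:ℕ) < r := by omega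
          simp [e]
      | succ v ihv =>
        intro ν hν hv
        have hsub : Q r ν ⊆ Q (r+1) ν := by
          intro κ; rw [mem_Q, mem_Q]; rintro ⟨h1, h2⟩; exact ⟨h1, fun i hi => h2 i (by omega)⟩
        rw [← sum_sdiff hsub, ih hrk.le ν hν, gstep _ (cz ν) (fun i : Fin k => if (i : ℕ) < r + 1 then n + 1 else n) R]
        have second : (fun i : Fin k => if (i : ℕ) < r then n + 1 else n) =
          Function.update (fun i : Fin k => if (i : ℕ) < r + 1 then n + 1 else n) R
           ((fun i : Fin k => if (i : ℕ) < r + 1 then n + 1 else n) R - 1) := by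
          ext i
          by_cases hir : i = R
          · subst hir; simp [hR]
          · rw [Function.update_of_ne hir]
            have : (i:ℕ) ≠ r := fun h => hir (Fin.ext h)
            have e : (i:ℕ) < r + 1 ↔ (i:ℕ) < r := by omega
            simp [e]
        rw [← second]
        congr 1
        by_cases hc : ∃ hl : r + 1 < k, ν ⟨r+1, hl⟩ = ν R
        · obtain ⟨hl, hc⟩ := hc
          rw [geq _ _ _ R ⟨r+1, hl⟩ rfl]
          · apply sum_eq_zero
            intro κ hκ
            exfalso
            rw [mem_sdiff, mem_Q, mem_Q] at hκ
            obtain ⟨⟨h1, h2⟩, h3⟩ := hκ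
            apply h3
            refine ⟨h1, fun i hi => ?_⟩
            by_cases hir : i = R
            · rw [hir]
              have a1 : κ R ≤ ν R := h1.1 R
              have a2 := h2 ⟨r+1, hl⟩ le_rfl
              have a3 : κ ⟨r+1, hl⟩ ≤ κ R := h1.2 (by simp [hR, Fin.le_def])
              omega
            · exact h2 i (by have : (i:ℕ) ≠ r := fun h => hir (Fin.ext h)
                             omega)
          · rw [Function.update_self, Function.update_of_ne (by simp [hR])]
            simp only [cz]; omega
          · simp [hR]
        · push Not at hc
          have han : Antitone (Function.update ν R v) := by
            apply antitone_update hν _ _ (by omega)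
            intro r' hr'
            have hl : r + 1 < k := by have := r'.2; have : r < r' := hr'; omega
            have h1 := hc hl
            have h2 : ν ⟨r+1, hl⟩ ≤ ν R := hν (by simp [hR, Fin.le_def])
            have h3 : ν r' ≤ ν ⟨r+1, hl⟩ := hν (by
              have : r < r' := hr'
              simp [Fin.le_def]; omega)
            omega
          have hQ : Q (r+1) ν \ Q r ν = Q (r+1) (Function.update ν R v) := by
            ext κ
            rw [mem_sdiff, mem_Q, mem_Q, mem_Q]
            constructor
            · rintro ⟨⟨h1, h2⟩, h3⟩
              have hne : κ R ≠ ν R := by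
                intro h
                apply h3
                refine ⟨h1, fun i hi => ?_⟩
                by_cases hir : i = R
                · rw [hir, h]
                · exact h2 i (by have : (i:ℕ) ≠ r := fun h => hir (Fin.ext h)
                                 omega)
              refine ⟨⟨?_, h1.2⟩, ?_⟩
              · intro i
                change κ i ≤ Function.update ν R v i
                by_cases hir : i = R
                · have h9 : κ R ≤ ν R := h1.1 R
                  rw [hir, Function.update_self]; omega
                · rw [Function.update_of_ne hir]; exact h1.1 i
              · intro i hi
                rw [Function.update_of_ne (by rintro rfl; simp [hR] at hi)]; exact h2 i hi
            · rintro ⟨h1, h2⟩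
              have hR1 : κ R ≤ v := by have := h1.1 R; rwa [Function.update_self] at this
              refine ⟨⟨⟨?_, h1.2⟩, ?_⟩, ?_⟩
              · intro i
                change κ i ≤ ν i
                by_cases hir : i = R
                · rw [hir]; omega
                · have := h1.1 i; rwa [Function.update_of_ne hir] at this
              · intro i hi
                have := h2 i hi
                rwa [Function.update_of_ne (by rintro rfl; simp [hR] at hi)] at this
              · rintro ⟨-, h3⟩
                have := h3 R le_rfl
                omega
          rw [hQ, ihv _ han (by simp)]
          congr 2
          ext i
          by_cases hir : i = R
          · subst hir; simp [cz, hv]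
          · simp [cz, Function.update_of_ne hir]
    intro ν hν
    exact key _ ν hν rfl

lemma det_step (μ ν : Fin k → ℕ) (hν : Antitone ν) (n : ℚ) :
    (GM (cz μ) (cz ν) (fun _ => n + 1)).det = ∑ κ ∈ P ν, (GM (cz μ) (cz κ) (fun _ => n)).det := by
  have := sumstep μ n k le_rfl ν hν
  have e : Q k ν = P ν := by
    ext κ; rw [mem_Q, mem_P]
    constructor
    · exact fun h => h.1
    · exact fun h => ⟨h, fun i hi => absurd i.2 (by omega)⟩
  rw [e] at this
  rw [this]; congr 2; ext i; simp [i.2]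

lemma det_block_zero (M : Matrix (Fin k) (Fin k) ℚ) (r : Fin k)
    (h : ∀ i j, r ≤ i → j ≤ r → M i j = 0) : M.det = 0 := by
  rw [Matrix.det_apply]
  apply sum_eq_zero
  intro σ _
  obtain ⟨j, hj, hj'⟩ : ∃ j, j ≤ r ∧ r ≤ σ j := by
    by_contra hcon
    push Not at hcon
    have : (Iic r).card ≤ (Iio r).card := by
      apply card_le_card_of_injOn σ
      · intro j hj; simp at hj ⊢; exact hcon j hj
      · exact σ.injective.injOn
    simp at this
  have hz : ∏ i, M (σ i) i = 0 := prod_eq_zero (mem_univ j) (h _ _ hj' hj)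
  rw [hz, smul_zero]

lemma det_block_zero' (M : Matrix (Fin k) (Fin k) ℚ) (r : Fin k)
    (h : ∀ i j, i ≤ r → r ≤ j → M i j = 0) : M.det = 0 := by
  rw [← Matrix.det_transpose]
  exact det_block_zero _ r (fun i j h1 h2 => h j i h2 h1)

lemma det_zero (μ ν : Fin k → ℕ) (hμ : Antitone μ) (hν : Antitone ν) :
    (GM (cz μ) (cz ν) (fun _ => 0)).det = if μ = ν then 1 else 0 := by
  split_ifs with h
  · subst h
    rw [Matrix.det_of_isUpperTriangular]
    · simp [GM, hq_c0]
    · intro i j hij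
      simp only [id] at hij
      simp only [GM, Matrix.of_apply, cz]
      apply hq_neg
      have := hμ hij.le
      have : (j:ℕ) < i := hij
      omega
  · by_cases hle : μ ≤ ν
    · obtain ⟨r, hr⟩ : ∃ r, μ r < ν r := by
        by_contra hcon; push Not at hcon; exact h (le_antisymm hle hcon)
      apply det_block_zero' _ r
      intro i j hi hj
      simp only [GM, Matrix.of_apply, cz]
      have h1 := hμ hj
      have h2 := hν hi
      have h3 : (i:ℕ) ≤ j := hi.trans hj
      have e : (0 : ℚ) + (i:ℕ) - (j:ℕ) = -(((j - i : ℕ)) : ℚ) := by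
        rw [Nat.cast_sub h3]; ring
      rw [e]; apply hq_zero; omega
    · obtain ⟨r, hr⟩ : ∃ r, ν r < μ r := by
        by_contra hcon; push Not at hcon; exact hle hcon
      apply det_block_zero _ r
      intro i j hi hj
      simp only [GM, Matrix.of_apply, cz]
      have h1 := hμ hj
      have h2 := hν hi
      have h3 : (j:ℕ) ≤ i := hj.trans hi
      apply hq_neg; omega

noncomputable def Z : ℕ → (Fin k → ℕ) → (Fin k → ℕ) → ℚ
  | 0, μ, ν => if μ = ν then 1 else 0
  | n+1, μ, ν => ∑ κ ∈ P ν, Z n μ κ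

lemma det_eq_Z (n : ℕ) (μ ν : Fin k → ℕ) (hμ : Antitone μ) (hν : Antitone ν) :
    (GM (cz μ) (cz ν) (fun _ => (n : ℚ))).det = Z n μ ν := by
  induction n generalizing ν with
  | zero => simpa [Z] using det_zero μ ν hμ hν
  | succ n ih =>
    push_cast
    rw [det_step μ ν hν, Z]
    exact sum_congr rfl (fun κ hκ => ih κ (mem_P.1 hκ).2)

lemma Z_le (n : ℕ) (μ ν : Fin k → ℕ) (h : Z n μ ν ≠ 0) : μ ≤ ν := by
  induction n generalizing ν with
  | zero => simp only [Z] at h; split_ifs at h with h1 <;> simp_all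
  | succ n ih =>
    rw [Z] at h
    obtain ⟨κ, hκ, h2⟩ := exists_ne_zero_of_sum_ne_zero h
    exact (ih κ h2).trans (mem_P.1 hκ).1

lemma Z_add (a b : ℕ) (μ ν : Fin k → ℕ) (hν : Antitone ν) :
    Z (a + b) μ ν = ∑ κ ∈ P ν, Z a μ κ * Z b κ ν := by
  induction b generalizing ν with
  | zero =>
    rw [sum_eq_single ν]
    · simp [Z]
    · intro κ _ h; simp [Z, h]
    · intro h; exact absurd (mem_P.2 ⟨le_rfl, hν⟩) h
  | succ b ih =>
    rw [← add_assoc, Z]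
    simp only [Z, mul_sum]
    rw [sum_comm]
    apply sum_congr rfl
    intro κ hκ
    obtain ⟨h1, h2⟩ := mem_P.1 hκ
    rw [ih κ h2]
    apply sum_subset
    · intro x hx; exact mem_P.2 ⟨(mem_P.1 hx).1.trans h1, (mem_P.1 hx).2⟩
    · intro x hx hx'
      have : Z b x κ = 0 := by
        by_contra hh
        exact hx' (mem_P.2 ⟨Z_le _ _ _ hh, (mem_P.1 hx).2⟩)
      rw [this, mul_zero]

end PSPos

namespace PSPos
open Finset
variable {k : ℕ}

open Polynomial in
noncomputable def hp (r c : ℤ) : ℚ[X] :=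
  if c < 0 then 0 else C (1 / (c.toNat.factorial : ℚ)) * ∏ s ∈ range c.toNat, (X + C ((r : ℚ) + s))

lemma hp_eval (r c : ℤ) (x : ℚ) : (hp r c).eval x = hq (x + r) c := by
  unfold hp hq
  split_ifs with h
  · simp
  · rw [Polynomial.eval_mul, Polynomial.eval_prod]
    simp only [Polynomial.eval_C, Polynomial.eval_add, Polynomial.eval_X]
    simp only [add_assoc]
    ring

/-- the quotient of `hp` by `X`, when divisible -/
lemma hp_X (d : ℕ) (c : ℤ) (h : (d : ℤ) < c) :
    ∃ q : Polynomial ℚ, hp (-(d : ℤ)) c = Polynomial.X * q ∧ 0 ≤ (-1) ^ d * q.eval 0 := by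
  lift c to ℕ using by omega
  have hd : d < c := by omega
  obtain ⟨e, rfl⟩ : ∃ e, c = d + (1 + e) := ⟨c - d - 1, by omega⟩
  refine ⟨Polynomial.C (1 / ((d + (1 + e)).factorial : ℚ)) *
    ((∏ s ∈ range d, (Polynomial.X + Polynomial.C (-(d : ℚ) + s))) *
    ∏ s ∈ range e, (Polynomial.X + Polynomial.C (1 + (s : ℚ)))), ?_, ?_⟩
  · have hneg : ¬ (((d + (1 + e) : ℕ) : ℤ) < 0) := by omega
    unfold hp
    rw [if_neg hneg, Int.toNat_natCast, prod_range_add, prod_range_add]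
    have e1 : ∏ x ∈ range e, (Polynomial.X + Polynomial.C (((-(d : ℤ) : ℤ) : ℚ) + ((d + (1 + x) : ℕ) : ℚ)))
       = ∏ s ∈ range e, (Polynomial.X + Polynomial.C (1 + (s : ℚ))) := by
      apply prod_congr rfl
      intro x _
      congr 2
      push_cast; ring
    rw [e1]
    simp
    ring
  · simp only [Polynomial.eval_mul, Polynomial.eval_prod, Polynomial.eval_C, Polynomial.eval_add,
      Polynomial.eval_X, zero_add]
    have e2 : ∏ s ∈ range d, (-(d : ℚ) + s) = (-1) ^ d * ∏ s ∈ range d, ((d : ℚ) - s) := by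
      rw [← card_range d, ← prod_const, card_range, ← prod_mul_distrib]
      apply prod_congr rfl; intro x _; ring
    rw [e2]
    have e3 : 0 ≤ ∏ s ∈ range d, ((d : ℚ) - s) := by
      apply prod_nonneg
      intro s hs
      have : s < d := by simpa using hs
      have : (s : ℚ) < d := by exact_mod_cast this
      linarith
    have e4 : 0 ≤ ∏ s ∈ range e, (1 + (s : ℚ)) := prod_nonneg (fun s _ => by positivity)
    have e5 : ((-1 : ℚ) ^ d) * (-1) ^ d = 1 := by rw [← mul_pow]; simp
    calc (0:ℚ) ≤ (1 / ((d + (1 + e)).factorial : ℚ)) *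
          ((∏ s ∈ range d, ((d : ℚ) - s)) * ∏ s ∈ range e, (1 + (s : ℚ))) := by positivity
      _ = (((-1 : ℚ) ^ d) * (-1) ^ d) * ((1 / ((d + (1 + e)).factorial : ℚ)) *
          ((∏ s ∈ range d, ((d : ℚ) - s)) * ∏ s ∈ range e, (1 + (s : ℚ)))) := by rw [e5, one_mul]
      _ = _ := by ring

noncomputable def DM (μ ν : Fin k → ℕ) : Matrix (Fin k) (Fin k) (Polynomial ℚ) :=
  Matrix.of fun i j => hp ((i : ℕ) - (j : ℕ)) ((ν i : ℤ) - μ j + (j : ℕ) - (i : ℕ))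

lemma DM_eval (μ ν : Fin k → ℕ) (x : ℚ) :
    (DM μ ν).det.eval x = (GM (cz μ) (cz ν) (fun _ => x)).det := by
  rw [← Polynomial.coe_evalRingHom, RingHom.map_det]
  congr 1
  ext i j
  simp only [RingHom.mapMatrix_apply, Matrix.map_apply, DM, GM, Matrix.of_apply,
    Polynomial.coe_evalRingHom, hp_eval, cz]
  congr 1
  push_cast; ring

lemma DM_eval_nat (μ ν : Fin k → ℕ) (hμ : Antitone μ) (hν : Antitone ν) (n : ℕ) :
    (DM μ ν).det.eval (n : ℚ) = Z n μ ν := by rw [DM_eval, det_eq_Z _ _ _ hμ hν]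

lemma DM_coeff_zero (μ ν : Fin k → ℕ) (hμ : Antitone μ) (hν : Antitone ν) :
    (DM μ ν).det.coeff 0 = if μ = ν then 1 else 0 := by
  rw [Polynomial.coeff_zero_eq_eval_zero]
  have := DM_eval_nat μ ν hμ hν 0
  simpa [Z] using this

lemma connected_case (k : ℕ) (μ ν : Fin (k+1) → ℕ) (hμ : Antitone μ)
    (h0 : μ 0 < ν 0) (h : ∀ i : Fin k, μ i.castSucc < ν i.succ) :
    0 ≤ (DM μ ν).det.coeff 1 := by
  have hq' : ∀ j : Fin (k+1), ∃ q : Polynomial ℚ, DM μ ν 0 j = Polynomial.X * q ∧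
      0 ≤ (-1) ^ (j : ℕ) * q.eval 0 := by
    intro j
    obtain ⟨q, hq1, hq2⟩ := hp_X j ((ν 0 : ℤ) - μ j + (j : ℕ) - ((0 : Fin (k+1)) : ℕ)) (by
      have := hμ (Fin.zero_le j); simp; omega)
    refine ⟨q, ?_, hq2⟩
    rw [← hq1]
    simp [DM]
  choose q hq1 hq2 using hq'
  have hdet : (DM μ ν).det = Polynomial.X * ((DM μ ν).updateRow 0 q).det := by
    rw [← Matrix.det_updateRow_smul]
    congr 1
    ext1 i j
    by_cases hi : i = 0
    · subst hi; simp [hq1]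
    · simp [Matrix.updateRow_ne hi]
  rw [hdet, Polynomial.coeff_X_mul (n := 0),
    Polynomial.coeff_zero_eq_eval_zero, ← Polynomial.coe_evalRingHom, RingHom.map_det,
    Matrix.det_succ_column _ (Fin.last k)]
  have hent : ∀ (i : Fin k) (j : Fin (k+1)), i.succ ≤ j →
      (DM μ ν i.succ j).eval 0 = 0 := by
    intro i j hij
    simp only [DM, Matrix.of_apply, hp_eval]
    have h3 : (i : ℕ) + 1 ≤ j := by simpa [Fin.le_def] using hij
    have e : (0 : ℚ) + (((i.succ : Fin (k+1)) : ℕ) - (j : ℕ) : ℤ) = -(((j - (i + 1) : ℕ)) : ℚ) := by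
      rw [Nat.cast_sub h3]; simp
    rw [e]; apply hq_zero
    have h1 := h i
    have h2 : μ j ≤ μ i.castSucc := hμ (by simp [Fin.le_def]; omega)
    simp; omega
  rw [sum_eq_single 0]
  · have hsub : ((((Polynomial.evalRingHom (0:ℚ)).mapMatrix ((DM μ ν).updateRow 0 q)).submatrix
        (Fin.succAbove 0) (Fin.succAbove (Fin.last k)))).det = 1 := by
      rw [Matrix.det_of_isLowerTriangular]
      · apply prod_eq_one
        intro i _
        simp only [Matrix.submatrix_apply, RingHom.mapMatrix_apply, Matrix.map_apply,
          Fin.succAbove_zero, Fin.succAbove_last, Matrix.updateRow_ne (Fin.succ_ne_zero i),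
          Polynomial.coe_evalRingHom]
        simp only [DM, Matrix.of_apply, hp_eval]
        have e : (0 : ℚ) + (((i.succ : Fin (k+1)) : ℕ) - ((i.castSucc : Fin (k+1)) : ℕ) : ℤ) = 1 := by
          simp
        rw [e]; apply hq_one
        have := h i
        simp; omega
      · intro i j hij
        have hij' : i < j := hij
        simp only [Matrix.submatrix_apply, RingHom.mapMatrix_apply, Matrix.map_apply,
          Fin.succAbove_zero, Fin.succAbove_last, Matrix.updateRow_ne (Fin.succ_ne_zero i),
          Polynomial.coe_evalRingHom]
        apply hent
        simp [Fin.le_def]; exact hij'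
    rw [hsub]
    have := hq2 (Fin.last k)
    simpa using this
  · intro i _ hi
    obtain ⟨i', rfl⟩ := Fin.exists_succ_eq.2 hi
    simp only [RingHom.mapMatrix_apply, Matrix.map_apply,
          Matrix.updateRow_ne (Fin.succ_ne_zero i'),
          Polynomial.coe_evalRingHom]
    rw [hent i' _ (Fin.le_last _)]; simp
  · simp

lemma split_case (a b : ℕ) (μ ν : Fin (a + b) → ℕ)
    (h : ∀ (i : Fin b) (j : Fin a), ν (Fin.natAdd a i) ≤ μ (Fin.castAdd b j)) :
    (DM μ ν).det = (DM (μ ∘ Fin.castAdd b) (ν ∘ Fin.castAdd b)).det *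
      (DM (μ ∘ Fin.natAdd a) (ν ∘ Fin.natAdd a)).det := by
  rw [← Matrix.det_fromBlocks_zero₂₁ _
    (Matrix.of fun (i : Fin a) (j : Fin b) => DM μ ν (Fin.castAdd b i) (Fin.natAdd a j)),
    ← Matrix.det_submatrix_equiv_self (finSumFinEquiv (m := a) (n := b))]
  congr 1
  ext1 i j
  rcases i with i | i <;> rcases j with j | j
  · simp [DM]
  · simp
  · simp only [Matrix.submatrix_apply, finSumFinEquiv_apply_left, finSumFinEquiv_apply_right,
      Matrix.fromBlocks_apply₂₁, Matrix.zero_apply, DM, Matrix.of_apply]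
    unfold hp
    rw [if_pos]
    have := h i j
    have := j.2
    simp; omega
  · simp only [Matrix.submatrix_apply, finSumFinEquiv_apply_right,
      Matrix.fromBlocks_apply₂₂, DM, Matrix.of_apply, Function.comp]
    congr 1
    · simp
    · simp; ring

lemma coeff_one_nonneg (n : ℕ) : ∀ (μ ν : Fin n → ℕ), Antitone μ → Antitone ν →
    0 ≤ (DM μ ν).det.coeff 1 := by
  induction n using Nat.strong_induction_on with
  | _ n ih =>
    intro μ ν hμ hν
    by_cases hs : ∃ a b : ℕ, a < n ∧ b < n ∧ n = a + b ∧
        ∀ i j : Fin n, a ≤ i → (j : ℕ) < a → ν i ≤ μ j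
    · obtain ⟨a, b, ha, hb, rfl, hs⟩ := hs
      have ac : Antitone (μ ∘ Fin.castAdd b) := hμ.comp_monotone (fun x y hxy => Fin.le_def.2 (show (x : ℕ) ≤ y from hxy))
      have ac' : Antitone (ν ∘ Fin.castAdd b) := hν.comp_monotone (fun x y hxy => Fin.le_def.2 (show (x : ℕ) ≤ y from hxy))
      have an : Antitone (μ ∘ Fin.natAdd a) := hμ.comp_monotone (fun x y hxy => Fin.le_def.2 (Nat.add_le_add_left (show (x : ℕ) ≤ y from hxy) a))
      have an' : Antitone (ν ∘ Fin.natAdd a) := hν.comp_monotone (fun x y hxy => Fin.le_def.2 (Nat.add_le_add_left (show (x : ℕ) ≤ y from hxy) a))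
      rw [split_case a b μ ν (fun i j => hs _ _ (by simp) (by simp)), Polynomial.mul_coeff_one,
        DM_coeff_zero _ _ ac ac', DM_coeff_zero _ _ an an']
      have h1 := ih a ha _ _ ac ac'
      have h2 := ih b hb _ _ an an'
      have : ∀ p : Prop, [Decidable p] → (0 : ℚ) ≤ if p then 1 else 0 := by
        intro p _; split_ifs <;> norm_num
      exact add_nonneg (mul_nonneg (this _) h2) (mul_nonneg h1 (this _))
    · push Not at hs
      cases n with
      | zero => simp [Polynomial.coeff_one]
      | succ k =>
        have hc : ∀ i : Fin k, μ i.castSucc < ν i.succ := by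
          intro r
          obtain ⟨i, j, hi, hj, hij⟩ := hs (r + 1) (k - r) (by omega) (by omega) (by omega)
          have h1 : ν i ≤ ν r.succ := hν (by simpa [Fin.le_def] using hi)
          have h2 : μ r.castSucc ≤ μ j := hμ (by simp [Fin.le_def]; omega)
          omega
        by_cases h0 : μ 0 < ν 0
        · exact connected_case k μ ν hμ h0 hc
        · cases k with
          | zero =>
            rw [Matrix.det_fin_one]
            simp only [DM, Matrix.of_apply, hp]
            split_ifs with h
            · simp
            · have : ((ν 0 : ℤ) - μ 0 + ((0 : Fin 1) : ℕ) - ((0 : Fin 1) : ℕ)).toNat = 0 := by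
                simp; omega
              rw [this]; simp [Polynomial.coeff_one]
          | succ k =>
            exfalso
            have h1 := hc 0
            have h2 : ν (Fin.succ 0) ≤ ν 0 := hν (Fin.zero_le _)
            simp at h1 h2
            omega

lemma poly_eq_of_nat (p q : Polynomial ℚ) (h : ∀ n : ℕ, p.eval (n : ℚ) = q.eval (n : ℚ)) :
    p = q := by
  apply Polynomial.eq_of_infinite_eval_eq
  apply Set.Infinite.mono (s := Set.range (fun n : ℕ => (n : ℚ)))
  · rintro _ ⟨n, rfl⟩; exact h n
  · exact Set.infinite_range_of_injective Nat.cast_injective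

lemma DM_deriv (μ ν : Fin k → ℕ) (hμ : Antitone μ) (hν : Antitone ν) :
    Polynomial.derivative (DM μ ν).det =
      ∑ κ ∈ P ν, Polynomial.C ((DM μ κ).det.coeff 1) * (DM κ ν).det := by
  apply poly_eq_of_nat
  intro n
  have key : (DM μ ν).det.comp (Polynomial.X + Polynomial.C (n : ℚ)) =
      ∑ κ ∈ P ν, (DM μ κ).det * Polynomial.C (Z n κ ν) := by
    apply poly_eq_of_nat
    intro s
    rw [Polynomial.eval_comp, Polynomial.eval_finsetSum]
    have : Polynomial.eval (s : ℚ) (Polynomial.X + Polynomial.C (n : ℚ)) = ((s + n : ℕ) : ℚ) := by simp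
    rw [this, DM_eval_nat _ _ hμ hν, Z_add _ _ _ _ hν]
    apply sum_congr rfl
    intro κ hκ
    rw [Polynomial.eval_mul, DM_eval_nat _ _ hμ (mem_P.1 hκ).2, Polynomial.eval_C]
  have k2 := congrArg (fun p => (Polynomial.derivative p).eval 0) key
  simp only [Polynomial.derivative_comp, Polynomial.eval_mul, Polynomial.eval_comp,
    Polynomial.derivative_sum, Polynomial.eval_finsetSum, Polynomial.derivative_mul] at k2
  simp only [Polynomial.derivative_add, Polynomial.derivative_X, Polynomial.derivative_C,
    Polynomial.eval_add, Polynomial.eval_one, Polynomial.eval_X, Polynomial.eval_C, zero_add,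
    Polynomial.eval_mul, mul_zero, add_zero, one_mul] at k2
  rw [k2, Polynomial.eval_finsetSum]
  apply sum_congr rfl
  intro κ hκ
  rw [Polynomial.eval_mul, DM_eval_nat _ _ (mem_P.1 hκ).2 hν, Polynomial.eval_C,
    ← Polynomial.coeff_zero_eq_eval_zero, Polynomial.coeff_derivative]
  simp

lemma DM_coeff_nonneg (j : ℕ) : ∀ (μ ν : Fin k → ℕ), Antitone μ → Antitone ν →
    0 ≤ (DM μ ν).det.coeff j := by
  induction j with
  | zero =>
    intro μ ν hμ hν
    rw [DM_coeff_zero _ _ hμ hν]; split_ifs <;> norm_num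
  | succ j ih =>
    intro μ ν hμ hν
    have h := congrArg (fun p => p.coeff j) (DM_deriv μ ν hμ hν)
    simp only [Polynomial.coeff_derivative, Polynomial.finsetSum_coeff, Polynomial.coeff_C_mul] at h
    have h2 : 0 ≤ ∑ κ ∈ P ν, (DM μ κ).det.coeff 1 * (DM κ ν).det.coeff j :=
      sum_nonneg (fun κ hκ => mul_nonneg (coeff_one_nonneg _ _ _ hμ (mem_P.1 hκ).2)
        (ih _ _ (mem_P.1 hκ).2 hν))
    rw [← h] at h2
    exact nonneg_of_mul_nonneg_left h2 (by positivity)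

end PSPos

namespace PSPos
open Finset
variable {k : ℕ}

/-- fillings with values at most `s`, where the cells with value `< s` form the shape `ν` -/
noncomputable def A (m : ℕ) (b : Fin k → ℕ) (s : ℕ) (ν : Fin k → ℕ) :
    Finset (Fin k → Fin m → ℤ) := by
  classical exact (Finset.Icc 0 (fun i _ => (b i : ℤ))).filter (fun x =>
    (∀ i, Monotone (x i)) ∧ (∀ j, Monotone (fun i => x i j)) ∧ (∀ i j, x i j ≤ s) ∧
    ∀ i j, x i j < s ↔ (j : ℕ) < ν i)

lemma mem_A {m : ℕ} {b : Fin k → ℕ} {s : ℕ} {ν : Fin k → ℕ} {x : Fin k → Fin m → ℤ} :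
    x ∈ A m b s ν ↔ (∀ i j, 0 ≤ x i j ∧ x i j ≤ b i) ∧ (∀ i, Monotone (x i)) ∧
      (∀ j, Monotone (fun i => x i j)) ∧ (∀ i j, x i j ≤ s) ∧
      ∀ i j, x i j < s ↔ (j : ℕ) < ν i := by
  unfold A
  rw [mem_filter, mem_Icc]
  apply and_congr_left
  intro _
  constructor
  · intro h i j; exact ⟨h.1 i j, h.2 i j⟩
  · intro h; exact ⟨fun i j => (h i j).1, fun i j => (h i j).2⟩

noncomputable def shape {m : ℕ} (s : ℕ) (x : Fin k → Fin m → ℤ) : Fin k → ℕ :=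
  fun i => (univ.filter (fun j => x i j < s)).card

lemma lt_shape {m : ℕ} (s : ℕ) (x : Fin k → Fin m → ℤ) (i : Fin k) (hx : Monotone (x i))
    (j : Fin m) : x i j < s ↔ (j : ℕ) < shape s x i := by
  unfold shape
  constructor
  · intro h
    have : Iic j ⊆ univ.filter (fun j => x i j < s) := by
      intro l hl
      simp only [mem_Iic] at hl
      simp only [mem_filter, mem_univ, true_and]
      exact (hx hl).trans_lt h
    have := card_le_card this
    simp at this
    omega
  · intro h
    by_contra hc
    have : univ.filter (fun j => x i j < s) ⊆ Iio j := by
      intro l hl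
      simp only [mem_filter, mem_univ, true_and] at hl
      simp only [mem_Iio]
      by_contra hlj
      exact hc ((hx (not_lt.1 hlj)).trans_lt hl)
    have := card_le_card this
    simp at this
    omega

lemma card_lt (m c : ℕ) (h : c ≤ m) : (univ.filter (fun j : Fin m => (j : ℕ) < c)).card = c := by
  rw [Fin.card_filter_val_lt]; omega

lemma A_vanish {m : ℕ} {b : Fin k → ℕ} {s : ℕ} {ν : Fin k → ℕ} (hm : ∀ i, ν i ≤ m) (i : Fin k)
    (h1 : b i < s) (h2 : ν i ≠ m) : A m b s ν = ∅ := by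
  rw [eq_empty_iff_forall_notMem]
  intro x hx
  rw [mem_A] at hx
  have h3 : ν i < m := lt_of_le_of_ne (hm i) h2
  have h4 := (hx.2.2.2.2 i ⟨ν i, h3⟩).not
  have h5 := (hx.1 i ⟨ν i, h3⟩).2
  simp at h4
  omega

lemma A_step {m : ℕ} {b : Fin k → ℕ} {s : ℕ} {ν : Fin k → ℕ} (hm : ∀ i, ν i ≤ m)
    (hν : Antitone ν) (hc : ∀ i, b i ≤ s → ν i = m) :
    (A m b (s+1) ν).card = ∑ μ ∈ P ν, (A m b s μ).card := by
  rw [card_eq_sum_card_fiberwise (f := shape s) (t := P ν)]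
  · apply sum_congr rfl
    intro μ hμ
    obtain ⟨hμν, hμa⟩ := mem_P.1 hμ
    have hμν' : ∀ i, μ i ≤ ν i := hμν
    apply card_nbij' (fun (x : Fin k → Fin m → ℤ) i j => min (x i j) (s : ℤ))
      (fun (x : Fin k → Fin m → ℤ) i j => if (j : ℕ) < ν i then x i j else (s : ℤ) + 1)
    · intro x hx
      simp only [coe_filter, Set.mem_ofPred_eq, mem_A] at hx
      obtain ⟨⟨h1, h2, h3, h4, h5⟩, h6⟩ := hx
      simp only [mem_coe, mem_A]
      refine ⟨?_, ?_, ?_, ?_, ?_⟩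
      · intro i j
        have := h1 i j
        omega
      · intro i j j' hj
        exact min_le_min_right _ (h2 i hj)
      · intro j i i' hi
        exact min_le_min_right _ (h3 j hi)
      · intro i j; exact min_le_right _ _
      · intro i j
        rw [← h6, ← lt_shape s x i (h2 i)]
        simp
    · intro x hx
      simp only [mem_coe, mem_A] at hx
      obtain ⟨h1, h2, h3, h4, h5⟩ := hx
      simp only [coe_filter, Set.mem_ofPred_eq, mem_A]
      refine ⟨⟨?_, ?_, ?_, ?_, ?_⟩, ?_⟩
      · intro i j
        have := h1 i j
        have := hc i
        have := j.2
        split_ifs <;> omega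
      · intro i j j' hj
        have hj' : (j : ℕ) ≤ j' := hj
        have a1 := h2 i hj
        have a2 := h4 i j
        dsimp only
        split_ifs <;> omega
      · intro j i i' hi
        have a1 := h3 j hi
        have a2 := h4 i j
        have a3 := hν hi
        dsimp only at a1 ⊢
        split_ifs <;> omega
      · intro i j
        have a2 := h4 i j
        push_cast
        split_ifs <;> omega
      · intro i j
        have a2 := h4 i j
        push_cast
        split_ifs <;> omega
      · ext i
        unfold shape
        rw [← card_lt m (μ i) ((hμν' i).trans (hm i))]
        congr 1
        ext j
        simp only [mem_filter, mem_univ, true_and]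
        rw [← h5 i j]
        have := h5 i j
        have := hμν' i
        split_ifs <;> omega
    · intro x hx
      simp only [coe_filter, Set.mem_ofPred_eq, mem_A] at hx
      obtain ⟨⟨h1, h2, h3, h4, h5⟩, h6⟩ := hx
      ext i j
      have a1 := h4 i j
      have a2 := h5 i j
      push_cast at a1 a2
      dsimp only
      split_ifs <;> omega
    · intro x hx
      simp only [mem_coe, mem_A] at hx
      obtain ⟨h1, h2, h3, h4, h5⟩ := hx
      ext i j
      have a1 := h4 i j
      have a2 := h5 i j
      have := hμν' i
      dsimp only
      split_ifs <;> omega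
  · intro x hx
    simp only [mem_coe, mem_A] at hx
    obtain ⟨h1, h2, h3, h4, h5⟩ := hx
    simp only [mem_coe, mem_P]
    constructor
    · intro i
      change shape s x i ≤ ν i
      rw [← card_lt m (ν i) (hm i)]
      apply card_le_card
      intro j
      simp only [mem_filter, mem_univ, true_and]
      rw [← h5 i j]; push_cast; omega
    · intro i i' hi
      apply card_le_card
      intro j
      simp only [mem_filter, mem_univ, true_and]
      have := h3 j hi
      dsimp only at this
      omega

lemma A_zero {m : ℕ} {b : Fin k → ℕ} {ν : Fin k → ℕ} (hm : ∀ i, ν i ≤ m) :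
    (A m b 0 ν).card = if ν = 0 then 1 else 0 := by
  split_ifs with h
  · subst h
    rw [card_eq_one]
    refine ⟨0, ?_⟩
    ext x
    rw [mem_A, mem_singleton]
    constructor
    · rintro ⟨h1, h2, h3, h4, h5⟩
      ext i j
      have := h1 i j
      have := h4 i j
      simp at this ⊢
      omega
    · rintro rfl
      refine ⟨?_, ?_, ?_, ?_, ?_⟩
      · intro i j; simp
      · intro i j j' _; simp
      · intro i j j' _; simp
      · intro i j; simp
      · intro i j; simp
  · rw [card_eq_zero, eq_empty_iff_forall_notMem]
    intro x hx
    rw [mem_A] at hx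
    obtain ⟨i, hi⟩ := Function.ne_iff.1 h
    have hi' : 0 < ν i := Nat.pos_of_ne_zero hi
    have h1 := hx.2.2.2.2 i ⟨0, lt_of_lt_of_le hi' (hm i)⟩
    have h2 := hx.1 i ⟨0, lt_of_lt_of_le hi' (hm i)⟩
    simp at h1
    omega

lemma A_multi {m : ℕ} {b : Fin k → ℕ} {s : ℕ} (n : ℕ) (hb : ∀ i, b i < s ∨ s + n ≤ b i + 1) :
    ∀ ν : Fin k → ℕ, (∀ i, ν i ≤ m) → Antitone ν → (∀ i, b i < s + n → ν i = m) →
    ((A m b (s+n) ν).card : ℚ) = ∑ μ ∈ P ν, ((A m b s μ).card : ℚ) * Z n μ ν := by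
  induction n with
  | zero =>
    intro ν hm hν hc
    rw [sum_eq_single ν]
    · simp [Z]
    · intro μ _ h; simp [Z, h]
    · intro h; exact absurd (mem_P.2 ⟨le_rfl, hν⟩) h
  | succ n ih =>
    intro ν hm hν hc
    have ih' := ih (fun i => by have := hb i; omega)
    rw [← add_assoc, A_step hm hν (fun i hi => hc i (by omega))]
    push_cast
    have e : ∀ κ ∈ P ν, ((A m b (s+n) κ).card : ℚ) =
        ∑ μ ∈ P ν, ((A m b s μ).card : ℚ) * Z n μ κ := by
      intro κ hκ
      obtain ⟨h1, h2⟩ := mem_P.1 hκ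
      have hκm : ∀ i, κ i ≤ m := fun i => (h1 i).trans (hm i)
      have ext : ∑ μ ∈ P κ, ((A m b s μ).card : ℚ) * Z n μ κ =
          ∑ μ ∈ P ν, ((A m b s μ).card : ℚ) * Z n μ κ := by
        apply sum_subset
        · intro x hx; exact mem_P.2 ⟨(mem_P.1 hx).1.trans h1, (mem_P.1 hx).2⟩
        · intro x hx hx'
          have : Z n x κ = 0 := by
            by_contra hh
            exact hx' (mem_P.2 ⟨Z_le _ _ _ hh, (mem_P.1 hx).2⟩)
          rw [this, mul_zero]
      by_cases hcκ : ∀ i, b i < s + n → κ i = m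
      · rw [ih' κ hκm h2 hcκ, ext]
      · push Not at hcκ
        obtain ⟨i, hi1, hi2⟩ := hcκ
        rw [A_vanish hκm i hi1 hi2, ← ext, eq_comm]
        simp only [card_empty, Nat.cast_zero]
        apply sum_eq_zero
        intro μ hμ
        have h3 : ∀ i, μ i ≤ κ i := (mem_P.1 hμ).1
        have hi3 : b i < s := by have := hb i; omega
        rw [A_vanish (fun i => (h3 i).trans (hκm i)) i hi3 (by
          have := h3 i; have := hκm i; omega)]
        simp
    rw [sum_congr rfl e, sum_comm]
    simp only [Z, mul_sum]

/-- nonnegativity of all coefficients -/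
def NN {σ : Type*} (p : MvPolynomial σ ℚ) : Prop := ∀ d, 0 ≤ p.coeff d

lemma NN.add {σ : Type*} {p q : MvPolynomial σ ℚ} (hp : NN p) (hq : NN q) : NN (p + q) := by
  intro d; rw [MvPolynomial.coeff_add]; exact add_nonneg (hp d) (hq d)

lemma NN.zero {σ : Type*} : NN (0 : MvPolynomial σ ℚ) := by intro d; simp

lemma NN.one {σ : Type*} : NN (1 : MvPolynomial σ ℚ) := by
  classical
  intro d; rw [MvPolynomial.coeff_one]; split_ifs <;> norm_num

lemma NN.X {σ : Type*} (i : σ) : NN (MvPolynomial.X i : MvPolynomial σ ℚ) := by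
  classical
  intro d; rw [MvPolynomial.coeff_X]; split_ifs <;> norm_num

lemma NN.mul {σ : Type*} {p q : MvPolynomial σ ℚ} (hp : NN p) (hq : NN q) : NN (p * q) := by
  classical
  intro d; rw [MvPolynomial.coeff_mul]; exact sum_nonneg (fun x _ => mul_nonneg (hp _) (hq _))

lemma NN.pow {σ : Type*} {p : MvPolynomial σ ℚ} (hp : NN p) (n : ℕ) : NN (p ^ n) := by
  induction n with
  | zero => rw [pow_zero]; exact NN.one
  | succ n ih => rw [pow_succ]; exact ih.mul hp

lemma NN.sum {σ ι : Type*} (s : Finset ι) (f : ι → MvPolynomial σ ℚ) (h : ∀ i ∈ s, NN (f i)) :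
    NN (∑ i ∈ s, f i) := by
  intro d; rw [MvPolynomial.coeff_sum]; exact sum_nonneg (fun x hx => h x hx d)

lemma NN.aeval {σ : Type*} {p : MvPolynomial σ ℚ} (hp : NN p) (f : Polynomial ℚ)
    (hf : ∀ j, 0 ≤ f.coeff j) : NN (Polynomial.aeval p f) := by
  rw [Polynomial.aeval_eq_sum_range]
  apply NN.sum
  intro i _ d
  rw [MvPolynomial.coeff_smul]
  exact mul_nonneg (hf i) (hp.pow i d)

lemma eval_aeval {σ : Type*} (y : σ → ℚ) (p : MvPolynomial σ ℚ) (f : Polynomial ℚ) :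
    MvPolynomial.eval y (Polynomial.aeval p f) = f.eval (MvPolynomial.eval y p) := by
  rw [Polynomial.aeval_eq_sum_range, map_sum, Polynomial.eval_eq_sum_range]
  apply sum_congr rfl
  intro i _
  rw [MvPolynomial.smul_eval, map_pow]

noncomputable def bd {K : ℕ} (y : Fin (K+1) → ℕ) : Fin (K+1) → ℕ := fun i => ∑ l ∈ Iic i, y l

lemma bd_mono {K : ℕ} (y : Fin (K+1) → ℕ) : Monotone (bd y) := by
  intro i j hij
  exact sum_le_sum_of_subset (Iic_subset_Iic.2 hij)

lemma bd_zero {K : ℕ} (y : Fin (K+1) → ℕ) : bd y 0 = y 0 := by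
  unfold bd
  rw [show Iic (0 : Fin (K+1)) = {0} from by ext i; simp]
  simp

lemma bd_succ {K : ℕ} (y : Fin (K+1) → ℕ) (r : ℕ) (h : r + 1 < K + 1) :
    bd y ⟨r+1, h⟩ = bd y ⟨r, by omega⟩ + y ⟨r+1, h⟩ := by
  unfold bd
  have : Iic (⟨r+1, h⟩ : Fin (K+1)) = insert ⟨r+1, h⟩ (Iic ⟨r, by omega⟩) := by
    ext i; simp only [mem_Iic, mem_insert, Fin.le_def, Fin.ext_iff]; omega
  rw [this, sum_insert (by simp), add_comm]

lemma main_ind {K m : ℕ} (r : ℕ) (hr : r < K + 1) :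
    ∃ F : (Fin (K+1) → ℕ) → MvPolynomial (Fin (K+1)) ℚ, ∀ ν, Antitone ν → (∀ i, ν i ≤ m) →
      NN (F ν) ∧ ∀ y : Fin (K+1) → ℕ, (∀ i, bd y i < bd y ⟨r, hr⟩ + 1 → ν i = m) →
        MvPolynomial.eval (fun i => (y i : ℚ)) (F ν) = (A m (bd y) (bd y ⟨r, hr⟩ + 1) ν).card := by
  classical
  induction r with
  | zero =>
    refine ⟨fun ν => Polynomial.aeval (MvPolynomial.X 0 + 1) (DM 0 ν).det, fun ν hν hm => ⟨?_, ?_⟩⟩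
    · exact ((NN.X 0).add NN.one).aeval _
        (fun j => DM_coeff_nonneg j _ _ (fun _ _ _ => le_rfl) hν)
    · intro y hc
      have h0 : bd y ⟨0, hr⟩ = y 0 := bd_zero y
      rw [h0] at hc ⊢
      have := A_multi (m := m) (b := bd y) (s := 0) (y 0 + 1) (fun i => by
        right
        have := bd_mono y (Fin.zero_le i)
        rw [bd_zero] at this; omega) ν hm hν (fun i hi => hc i (by omega))
      rw [zero_add] at this
      rw [this, eval_aeval, sum_eq_single 0]
      · rw [A_zero (by simp)]
        have h2 := DM_eval_nat (0 : Fin (K+1) → ℕ) ν (fun _ _ _ => le_rfl) hν (y 0 + 1)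
        rw [← h2]; simp
      · intro μ hμ h
        rw [A_zero (fun i => ((mem_P.1 hμ).1 i).trans (hm i))]; simp [h]
      · intro h; exact absurd (mem_P.2 ⟨fun i => Nat.zero_le _, fun _ _ _ => le_rfl⟩) h
  | succ r ih =>
    have hr' : r < K + 1 := by omega
    obtain ⟨F, hF⟩ := ih hr'
    refine ⟨fun ν => ∑ μ ∈ P ν, if (∀ i : Fin (K+1), (i : ℕ) ≤ r → μ i = m) then
      F μ * Polynomial.aeval (MvPolynomial.X ⟨r+1, hr⟩) (DM μ ν).det else 0,
      fun ν hν hm => ⟨?_, ?_⟩⟩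
    · apply NN.sum
      intro μ hμ
      obtain ⟨h1, h2⟩ := mem_P.1 hμ
      split_ifs
      · exact (hF μ h2 (fun i => (h1 i).trans (hm i))).1.mul
          ((NN.X _).aeval _ (fun j => DM_coeff_nonneg j _ _ h2 hν))
      · exact NN.zero
    · intro y hc
      have hs := bd_succ y r hr
      rw [hs] at hc ⊢
      have hord : ∀ i : Fin (K+1), bd y i < bd y ⟨r, hr'⟩ + 1 ∨
          bd y ⟨r, hr'⟩ + 1 + y ⟨r+1, hr⟩ ≤ bd y i + 1 := by
        intro i
        by_cases hi : (i : ℕ) ≤ r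
        · left
          have : bd y i ≤ bd y ⟨r, hr'⟩ := bd_mono y (Fin.le_def.2 hi)
          omega
        · right
          have : bd y ⟨r+1, hr⟩ ≤ bd y i := bd_mono y (Fin.le_def.2 (by simp; omega))
          omega
      have hA := A_multi (m := m) (b := bd y) (s := bd y ⟨r, hr'⟩ + 1) (y ⟨r+1, hr⟩) hord
        ν hm hν (fun i hi => hc i (by omega))
      rw [show bd y ⟨r, hr'⟩ + y ⟨r+1, hr⟩ + 1 = bd y ⟨r, hr'⟩ + 1 + y ⟨r+1, hr⟩ by omega, hA,
        map_sum]
      apply sum_congr rfl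
      intro μ hμ
      obtain ⟨h1, h2⟩ := mem_P.1 hμ
      have hμm : ∀ i, μ i ≤ m := fun i => (h1 i).trans (hm i)
      split_ifs with hcond
      · rw [map_mul, eval_aeval, MvPolynomial.eval_X, DM_eval_nat _ _ h2 hν]
        by_cases hcμ : ∀ i, bd y i < bd y ⟨r, hr'⟩ + 1 → μ i = m
        · rw [(hF μ h2 hμm).2 y hcμ]
        · have hZ : Z (y ⟨r+1, hr⟩) μ ν = 0 := by
            push Not at hcμ
            obtain ⟨i, hi1, hi2⟩ := hcμ
            have hir : ¬ (i : ℕ) ≤ r := fun h => hi2 (hcond i h)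
            have : bd y ⟨r+1, hr⟩ ≤ bd y i := bd_mono y (Fin.le_def.2 (by simp; omega))
            have hy0 : y ⟨r+1, hr⟩ = 0 := by omega
            rw [hy0, Z, if_neg]
            rintro rfl
            exact hi2 (hc i (by omega))
          rw [hZ]; simp
      · push Not at hcond
        obtain ⟨i, hi1, hi2⟩ := hcond
        have : bd y i ≤ bd y ⟨r, hr'⟩ := bd_mono y (Fin.le_def.2 hi1)
        rw [A_vanish hμm i (by omega) hi2]
        simp

end PSPos

theorem pitmanStanley_multivariate_positivity
    (k m : ℕ) (hk : 0 < k) (hm : 0 < m) :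
    ∃ f : MvPolynomial (Fin k) ℚ, (∀ d : Fin k →₀ ℕ, 0 ≤ f.coeff d) ∧
      ∀ y : Fin k → ℕ,
        MvPolynomial.eval (fun i : Fin k => (y i : ℚ)) f =
          Nat.card {x : Fin k → Fin m → ℤ //
            (∀ i : Fin k, Monotone (x i)) ∧
            (∀ (i : Fin k) (j : Fin m),
              0 ≤ x i j ∧ x i j ≤ ∑ l ∈ Finset.Iic i, (y l : ℤ)) ∧
            (∀ (i : Fin k) (hi : (i : ℕ) + 1 < k) (j : Fin m),
              x i j ≤ x ⟨(i : ℕ) + 1, hi⟩ j)} := by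
  obtain ⟨K, rfl⟩ : ∃ K, k = K + 1 := ⟨k - 1, by omega⟩
  obtain ⟨F, hF⟩ := PSPos.main_ind (K := K) (m := m) K (by omega)
  obtain ⟨h1, h2⟩ := hF (fun _ => m) (fun _ _ _ => le_rfl) (fun _ => le_rfl)
  refine ⟨F (fun _ => m), h1, fun y => ?_⟩
  rw [h2 y (fun _ _ => rfl), ← Nat.card_eq_finsetCard]
  congr 1
  apply Nat.card_congr
  apply Equiv.subtypeEquivRight
  intro x
  rw [PSPos.mem_A]
  have hb : ∀ i, ∑ l ∈ Finset.Iic i, (y l : ℤ) = (PSPos.bd y i : ℤ) := by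
    intro i; simp [PSPos.bd]
  simp only [hb]
  constructor
  · rintro ⟨a1, a2, a3, a4, a5⟩
    refine ⟨a2, a1, fun i hi j => a3 j (Fin.le_def.2 (by simp))⟩
  · rintro ⟨a1, a2, a3⟩
    have hlt : ∀ i j, x i j < ((PSPos.bd y ⟨K, by omega⟩ + 1 : ℕ) : ℤ) := by
      intro i j
      have e1 := (a2 i j).2
      have e2 : PSPos.bd y i ≤ PSPos.bd y ⟨K, by omega⟩ :=
        PSPos.bd_mono y (Fin.le_def.2 (by have := i.2; simp; omega))
      omega
    refine ⟨a2, a1, fun j => ?_, fun i j => (hlt i j).le, fun i j => ?_⟩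
    · rw [Fin.monotone_iff_le_succ]
      intro i
      exact a3 i.castSucc (by simp) j
    · exact iff_of_true (hlt i j) j.2
end
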